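/- Let d be an integer with d_1 ≤ ⋯ ≤ d_n ≤ d < δ and set i* = ⌊(δ−d)/2⌋. Then for all integers i > j ≥ i* (with d+i ≤ δ), one has a_{d+i} ≤ a_{d+j}, and B_{d+i} = x_n^{i−j}·S, where S is the set consisting of the a_{d+i} smallest monomials of B_{d+j} in the degree reverse lexicographic order; in particular every monomial of B_{d+i} is a multiple of one of the a_{d+i} smallest monomials of B_{d+j}. -/

import Mathlib

open MvPolynomial

/-- The total degree of an exponent vector. -/
def expDeg {n : ℕ} (μ : Fin n →₀ ℕ) : ℕ := μ.sum fun _ e => e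

/-- Strict degree reverse lexicographic order on exponent vectors, for variables
`x_1 > ⋯ > x_n` (indexed by `Fin n` in this order). -/
def DrlLT {n : ℕ} (a b : Fin n →₀ ℕ) : Prop :=
  expDeg a < expDeg b ∨
    (expDeg a = expDeg b ∧ ∃ i : Fin n, b i < a i ∧ ∀ j : Fin n, i < j → a j = b j)

/-- `μ` is the leading (degrevlex-largest) exponent of `p`. -/
def IsLeadExp {n : ℕ} {K : Type*} [CommSemiring K] (p : MvPolynomial (Fin n) K)
    (μ : Fin n →₀ ℕ) : Prop :=
  μ ∈ p.support ∧ ∀ ν ∈ p.support, ν ≠ μ → DrlLT ν μ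

/-- The initial ideal of `I` with respect to the degree reverse lexicographic order. -/
noncomputable def initialIdeal {n : ℕ} {K : Type*} [CommRing K]
    (I : Ideal (MvPolynomial (Fin n) K)) : Ideal (MvPolynomial (Fin n) K) :=
  Ideal.span { m | ∃ p ∈ I, p ≠ 0 ∧ ∃ μ, IsLeadExp p μ ∧ m = monomial μ (1 : K) }

/-- The standard monomials of degree `i` of `I` : exponents of the monomials of degree `i`
not lying in the initial ideal of `I`. -/
def stdMon {n : ℕ} {K : Type*} [CommRing K] (I : Ideal (MvPolynomial (Fin n) K)) (i : ℕ) :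
    Set (Fin n →₀ ℕ) :=
  { μ | expDeg μ = i ∧ monomial μ (1 : K) ∉ initialIdeal I }

/-- `μ` is a minimal monomial generator of the monomial ideal `M`. -/
def IsMinGen {n : ℕ} {K : Type*} [CommRing K] (M : Ideal (MvPolynomial (Fin n) K))
    (μ : Fin n →₀ ℕ) : Prop :=
  monomial μ (1 : K) ∈ M ∧ ∀ ν : Fin n →₀ ℕ, ν ≤ μ → ν ≠ μ → monomial ν (1 : K) ∉ M

/-- `μ` satisfies property `P` with respect to the monomial ideal `M`: if `m` is the largest
index of a variable dividing `x^μ`, then every monomial of the same degree in the variables of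
index `< m` also lies in `M`. -/
def SatisfiesP {n : ℕ} {K : Type*} [CommRing K] (M : Ideal (MvPolynomial (Fin n) K))
    (μ : Fin n →₀ ℕ) : Prop :=
  ∀ m : Fin n, μ m ≠ 0 → (∀ j : Fin n, m < j → μ j = 0) →
    ∀ ν : Fin n →₀ ℕ, expDeg ν = expDeg μ → (∀ j : Fin n, m ≤ j → ν j = 0) →
      monomial ν (1 : K) ∈ M

/-- Conjecture E (Pardue) holds for the ideal `I`: every minimal generator of the initial
ideal of `I` satisfies property `P`. -/
def ConjE {n : ℕ} {K : Type*} [CommRing K] (I : Ideal (MvPolynomial (Fin n) K)) : Prop :=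
  ∀ μ, IsMinGen (initialIdeal I) μ → SatisfiesP (initialIdeal I) μ

/-- `f` is a generic sequence of forms of degrees `d i` over the base field `F`: each `f i` is
homogeneous of degree `d i` and the family of all coefficients (at all monomials of degree
`d i`) is algebraically independent over `F`. -/
def IsGenericSeq (F : Type*) {K : Type*} [CommRing F] [CommRing K] [Algebra F K]
    {n r : ℕ} (d : Fin r → ℕ) (f : Fin r → MvPolynomial (Fin n) K) : Prop :=
  (∀ i, (f i).IsHomogeneous (d i)) ∧
    AlgebraicIndependent F
      (fun p : Σ i : Fin r, { μ : Fin n →₀ ℕ // expDeg μ = d i } => (f p.1).coeff p.2.1)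

/-- The projection `K[x_1,…,x_n,z] → K[x_1,…,x_n]` sending `z` (the last variable) to `0` and
fixing the other variables. -/
noncomputable def projMap (K : Type*) [CommRing K] (n : ℕ) :
    MvPolynomial (Fin (n + 1)) K →ₐ[K] MvPolynomial (Fin n) K :=
  aeval (fun i => Fin.lastCases 0 (fun j => X j) i)

/-- Embedding of exponent vectors of `K[x_1,…,x_n]` into those of `K[x_1,…,x_n,z]`
(`z`-exponent `0`). -/
noncomputable def embExp {n : ℕ} (μ : Fin n →₀ ℕ) : Fin (n + 1) →₀ ℕ :=
  Finsupp.embDomain ⟨Fin.castSucc, Fin.castSucc_injective n⟩ μ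

/-- Multiplication by `z^c` on exponent vectors in `K[x_1,…,x_n,z]`. -/
noncomputable def zShift {n : ℕ} (c : ℕ) (μ : Fin (n + 1) →₀ ℕ) : Fin (n + 1) →₀ ℕ :=
  μ + Finsupp.single (Fin.last n) c

/-- `f` (homogeneous of degree `e`) is semi-regular on `R/I`: in each degree `t`, the
multiplication map `(R/I)_t → (R/I)_{t+e}` is injective or surjective. -/
def SemiRegularOn {vars K : Type*} [CommRing K] (I : Ideal (MvPolynomial vars K))
    (f : MvPolynomial vars K) (e : ℕ) : Prop :=
  ∀ t : ℕ,
    (∀ p ∈ homogeneousSubmodule vars K t, f * p ∈ I → p ∈ I) ∨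
    (∀ q ∈ homogeneousSubmodule vars K (t + e),
      ∃ p ∈ homogeneousSubmodule vars K t, q - f * p ∈ I)

/-- The degree-`t` graded piece of `R/I`, as a `K`-submodule of the quotient. -/
noncomputable def quotDegPart {vars K : Type*} [CommRing K] (I : Ideal (MvPolynomial vars K))
    (t : ℕ) : Submodule K (MvPolynomial vars K ⧸ I) :=
  (homogeneousSubmodule vars K t).map (Ideal.Quotient.mkₐ K I).toLinearMap

/-! ### The `ℤ`-grading of a polynomial ring by total degree -/

/-- The forms of degree `t`, for an integer `t`; this is zero when `t < 0`. -/
noncomputable def gradedPart (σ K : Type*) [CommSemiring K] (t : ℤ) :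
    Submodule K (MvPolynomial σ K) :=
  weightedHomogeneousSubmodule K (fun _ => (1 : ℤ)) t

/-- The component of degree `t` of a polynomial, for an integer `t`. -/
noncomputable def gradedComp {σ K : Type*} [CommSemiring K] (t : ℤ) :
    MvPolynomial σ K →ₗ[K] MvPolynomial σ K :=
  weightedHomogeneousComponent (fun _ => (1 : ℤ)) t

section Grading

variable {σ K : Type*}

theorem weight_one_int (μ : σ →₀ ℕ) :
    Finsupp.weight (fun _ : σ => (1 : ℤ)) μ = (μ.degree : ℤ) := by
  rw [Finsupp.weight_apply, Finsupp.degree_apply, Finsupp.sum]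
  simp

theorem mem_gradedPart [CommSemiring K] {t : ℤ} {p : MvPolynomial σ K} :
    p ∈ gradedPart σ K t ↔ ∀ μ, coeff μ p ≠ 0 → (μ.degree : ℤ) = t := by
  simp only [gradedPart, mem_weightedHomogeneousSubmodule, IsWeightedHomogeneous, weight_one_int]

theorem coeff_gradedComp [CommSemiring K] (t : ℤ) (p : MvPolynomial σ K) (μ : σ →₀ ℕ) :
    coeff μ (gradedComp t p) = if (μ.degree : ℤ) = t then coeff μ p else 0 := by
  rw [gradedComp, coeff_weightedHomogeneousComponent, weight_one_int]

theorem gradedComp_mem [CommSemiring K] (t : ℤ) (p : MvPolynomial σ K) :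
    gradedComp t p ∈ gradedPart σ K t := by
  rw [mem_gradedPart]
  intro μ hμ
  rw [coeff_gradedComp] at hμ
  by_contra h
  exact hμ (if_neg h)

theorem gradedComp_of_mem [CommSemiring K] {t : ℤ} {p : MvPolynomial σ K}
    (hp : p ∈ gradedPart σ K t) : gradedComp t p = p := by
  ext μ
  rw [coeff_gradedComp]
  split_ifs with h
  · rfl
  · by_contra h'
    exact h (mem_gradedPart.1 hp μ (Ne.symm h'))

theorem gradedPart_mul_mem [CommSemiring K] {s t : ℤ} {p q : MvPolynomial σ K}
    (hp : p ∈ gradedPart σ K s) (hq : q ∈ gradedPart σ K t) : p * q ∈ gradedPart σ K (s + t) :=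
  IsWeightedHomogeneous.mul hp hq

theorem gradedPart_pow_mem [CommSemiring K] {p : MvPolynomial σ K}
    (hp : p ∈ gradedPart σ K 1) (k : ℕ) : p ^ k ∈ gradedPart σ K k := by
  have := IsWeightedHomogeneous.pow (w := fun _ => (1 : ℤ)) hp k
  simpa [gradedPart] using this

theorem X_mem_gradedPart [CommSemiring K] (i : σ) :
    (X i : MvPolynomial σ K) ∈ gradedPart σ K 1 :=
  isWeightedHomogeneous_X K (fun _ => (1 : ℤ)) i

theorem monomial_mem_gradedPart [CommSemiring K] (μ : σ →₀ ℕ) (c : K) :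
    monomial μ c ∈ gradedPart σ K μ.degree :=
  isWeightedHomogeneous_monomial _ _ _ (weight_one_int μ)

theorem mem_gradedPart_of_isHomogeneous [CommSemiring K] {p : MvPolynomial σ K} {e : ℕ}
    (hp : p.IsHomogeneous e) : p ∈ gradedPart σ K e := by
  rw [mem_gradedPart]
  intro μ hμ
  rw [Finsupp.degree_eq_weight_one]
  exact_mod_cast hp hμ

theorem gradedPart_eq_zero_of_neg [CommSemiring K] {t : ℤ} (ht : t < 0) {p : MvPolynomial σ K}
    (hp : p ∈ gradedPart σ K t) : p = 0 := by
  ext μ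
  by_contra h
  have := mem_gradedPart.1 hp μ (by simpa using h)
  omega

theorem gradedComp_mul [CommSemiring K] {s : ℤ} (t : ℤ) {p : MvPolynomial σ K}
    (hp : p ∈ gradedPart σ K s) (q : MvPolynomial σ K) :
    gradedComp t (p * q) = p * gradedComp (t - s) q := by
  classical
  ext μ
  rw [coeff_gradedComp, coeff_mul, coeff_mul]
  have h : ∀ x ∈ Finset.HasAntidiagonal.antidiagonal μ, coeff x.1 p * coeff x.2 (gradedComp (t - s) q) =
      if (μ.degree : ℤ) = t then coeff x.1 p * coeff x.2 q else 0 := by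
    intro x hx
    rw [coeff_gradedComp]
    by_cases h0 : coeff x.1 p = 0
    · simp [h0]
    have h1 := mem_gradedPart.1 hp _ h0
    have h2 : (x.1.degree : ℤ) + x.2.degree = μ.degree := by
      rw [← Finset.HasAntidiagonal.mem_antidiagonal.1 hx, map_add]
      push_cast
      rfl
    have h3 : (x.2.degree : ℤ) = t - s ↔ (μ.degree : ℤ) = t := by omega
    simp [h3]
  rw [Finset.sum_congr rfl h]
  split_ifs <;> simp

theorem gradedComp_sum_mul [CommRing K] {ι : Type*} [Fintype ι] {e : ι → ℤ}
    {f : ι → MvPolynomial σ K} (hf : ∀ i, f i ∈ gradedPart σ K (e i)) (t : ℤ)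
    (c : ι → MvPolynomial σ K) :
    gradedComp t (∑ i, c i * f i) = ∑ i, gradedComp (t - e i) (c i) * f i := by
  rw [map_sum]
  refine Finset.sum_congr rfl fun i _ => ?_
  rw [mul_comm, gradedComp_mul t (hf i), mul_comm]

theorem gradedComp_mem_span [CommRing K] {ι : Type*} [Fintype ι] {e : ι → ℤ}
    {f : ι → MvPolynomial σ K} (hf : ∀ i, f i ∈ gradedPart σ K (e i)) (t : ℤ)
    {p : MvPolynomial σ K} (hp : p ∈ Ideal.span (Set.range f)) :
    gradedComp t p ∈ Ideal.span (Set.range f) := by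
  obtain ⟨c, rfl⟩ := Ideal.mem_span_range_iff_exists_fun.1 hp
  rw [gradedComp_sum_mul hf]
  exact Ideal.mem_span_range_iff_exists_fun.2 ⟨_, rfl⟩

theorem exists_graded_of_mem_span [CommRing K] {ι : Type*} [Fintype ι] {e : ι → ℤ}
    {f : ι → MvPolynomial σ K} (hf : ∀ i, f i ∈ gradedPart σ K (e i)) {t : ℤ}
    {p : MvPolynomial σ K} (hpt : p ∈ gradedPart σ K t) (hp : p ∈ Ideal.span (Set.range f)) :
    ∃ c : ι → MvPolynomial σ K, (∀ i, c i ∈ gradedPart σ K (t - e i)) ∧ p = ∑ i, c i * f i := by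
  obtain ⟨c, rfl⟩ := Ideal.mem_span_range_iff_exists_fun.1 hp
  refine ⟨fun i => gradedComp (t - e i) (c i), fun i => gradedComp_mem _ _, ?_⟩
  rw [← gradedComp_sum_mul hf, gradedComp_of_mem hpt]

end Grading

/-! ### Standard monomials of ideals with a Lefschetz-type linear form -/

/-- The linear form `l` is a strong Lefschetz element on `R/I` in the narrow sense with socle degree
`c`: multiplication by `l ^ (c - 2 * s)` is a bijection from degree `s` to degree `c - s`. -/
structure IsLefschetz {σ K : Type*} [CommRing K] (I : Ideal (MvPolynomial σ K))
    (l : MvPolynomial σ K) (c : ℤ) : Prop where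
  inj : ∀ (s : ℤ) (k : ℕ), 2 * s + k = c → ∀ p ∈ gradedPart σ K s, l ^ k * p ∈ I → p ∈ I
  surj : ∀ (s : ℤ) (k : ℕ), 2 * s + k = c → ∀ y ∈ gradedPart σ K (s + k),
    ∃ p ∈ gradedPart σ K s, y - l ^ k * p ∈ I

section StandardMonomials

variable {n : ℕ} {K : Type*}

theorem expDeg_eq_degree (μ : Fin n →₀ ℕ) : expDeg μ = μ.degree := rfl

theorem expDeg_add (μ ν : Fin n →₀ ℕ) : expDeg (μ + ν) = expDeg μ + expDeg ν := by
  simp [expDeg_eq_degree]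

theorem DrlLT.add_left {μ ν : Fin n →₀ ℕ} (h : DrlLT μ ν) (ρ : Fin n →₀ ℕ) :
    DrlLT (ρ + μ) (ρ + ν) := by
  rcases h with h | ⟨h, i, hi, hj⟩
  · left
    simp only [expDeg_add]
    omega
  · right
    refine ⟨by simp only [expDeg_add, h], i, by simpa using hi, fun j hij => by simp [hj j hij]⟩

theorem monomial_mem_initialIdeal_iff [Field K] {I : Ideal (MvPolynomial (Fin n) K)}
    (hI : ∀ (t : ℤ), ∀ p ∈ I, gradedComp t p ∈ I) (μ : Fin n →₀ ℕ) :
    monomial μ (1 : K) ∈ initialIdeal I ↔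
      ∃ p ∈ I, p ∈ gradedPart (Fin n) K μ.degree ∧ IsLeadExp p μ := by
  constructor
  · intro h
    have hset : { m : MvPolynomial (Fin n) K | ∃ p ∈ I, p ≠ 0 ∧ ∃ μ, IsLeadExp p μ ∧
        m = monomial μ (1 : K) } =
        (fun s => monomial s (1 : K)) '' { ν | ∃ p ∈ I, p ≠ 0 ∧ IsLeadExp p ν } := by
      ext m
      constructor
      · rintro ⟨p, hp, h0, ν, hν, rfl⟩
        exact ⟨ν, ⟨p, hp, h0, hν⟩, rfl⟩
      · rintro ⟨ν, ⟨p, hp, h0, hν⟩, rfl⟩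
        exact ⟨p, hp, h0, ν, hν, rfl⟩
    rw [initialIdeal, hset, mem_ideal_span_monomial_image] at h
    obtain ⟨ν, ⟨p, hp, -, hν⟩, hle⟩ := h μ (by simp)
    obtain ⟨ρ, rfl⟩ := exists_add_of_le hle
    have hdeg : ((ν + ρ).degree : ℤ) = (ρ.degree : ℤ) + ν.degree := by
      rw [map_add]
      push_cast
      ring
    refine ⟨monomial ρ 1 * gradedComp ν.degree p, I.mul_mem_left _ (hI _ _ hp), ?_, ?_, ?_⟩
    · rw [hdeg]
      exact gradedPart_mul_mem (monomial_mem_gradedPart _ _) (gradedComp_mem _ _)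
    · rw [mem_support_iff, add_comm, coeff_monomial_mul, coeff_gradedComp]
      simpa using hν.1
    · intro τ hτ hne
      rw [mem_support_iff, coeff_monomial_mul'] at hτ
      split_ifs at hτ with hρ
      · obtain ⟨τ', rfl⟩ := exists_add_of_le hρ
        rw [add_tsub_cancel_left, coeff_gradedComp] at hτ
        have hτ' : τ' ∈ p.support := by
          rw [mem_support_iff]
          intro h0
          simp [h0] at hτ
        have hne' : τ' ≠ ν := by
          rintro rfl
          exact hne (add_comm _ _)
        rw [add_comm ν]
        exact (hν.2 τ' hτ' hne').add_left ρ
      · exact absurd rfl hτ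
  · rintro ⟨p, hp, -, hμ⟩
    refine Ideal.subset_span ⟨p, hp, ?_, μ, hμ, rfl⟩
    rintro rfl
    simpa using hμ.1

theorem stdMon_of_add [CommRing K] {I : Ideal (MvPolynomial (Fin n) K)} {μ ν : Fin n →₀ ℕ}
    (h : monomial (μ + ν) (1 : K) ∉ initialIdeal I) : monomial μ (1 : K) ∉ initialIdeal I := by
  intro h'
  apply h
  have : monomial (μ + ν) (1 : K) = monomial ν 1 * monomial μ 1 := by
    rw [monomial_mul, one_mul, add_comm]
  rw [this]
  exact Ideal.mul_mem_left _ _ h'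

/-- If `x_n ^ k` is injective from degree `s` to degree `s + k`, multiplication by it preserves
standard monomials of degree `s`. -/
theorem add_single_mem_stdMon [Field K] {I : Ideal (MvPolynomial (Fin n) K)}
    (hI : ∀ (t : ℤ), ∀ p ∈ I, gradedComp t p ∈ I) {z : Fin n} (hz : ∀ j, j ≤ z) {s k : ℕ}
    (hinj : ∀ p ∈ gradedPart (Fin n) K s, X z ^ k * p ∈ I → p ∈ I)
    {ν : Fin n →₀ ℕ} (hν : ν ∈ stdMon I s) : ν + Finsupp.single z k ∈ stdMon I (s + k) := by
  obtain ⟨hdeg, hstd⟩ := hν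
  refine ⟨by rw [expDeg_add, hdeg]; simp [expDeg_eq_degree], fun hmem => hstd ?_⟩
  obtain ⟨p, hp, hpd, hlead⟩ := (monomial_mem_initialIdeal_iff hI _).1 hmem
  have hdvd : ∀ τ ∈ p.support, Finsupp.single z k ≤ τ := by
    intro τ hτ
    rw [Finsupp.single_le_iff]
    by_cases hne : τ = ν + Finsupp.single z k
    · simp [hne]
    have hd : expDeg τ = expDeg (ν + Finsupp.single z k) := by
      have := mem_gradedPart.1 hpd τ (mem_support_iff.1 hτ)
      rw [expDeg_eq_degree, expDeg_eq_degree]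
      exact_mod_cast this
    rcases hlead.2 τ hτ hne with h | ⟨-, i, hi, hj⟩
    · omega
    · rcases (hz i).eq_or_lt with rfl | hlt
      · simp at hi
        omega
      · simp [hj z hlt]
  obtain ⟨q, rfl⟩ : ∃ q, p = X z ^ k * q := by
    rw [X_pow_eq_monomial]
    exact monomial_one_dvd_iff_modMonomial_eq_zero.2 (by
      ext τ
      by_cases h : Finsupp.single z k ≤ τ
      · rw [coeff_modMonomial_of_le _ h, coeff_zero]
      · rw [coeff_modMonomial_of_not_le _ h, coeff_zero]
        by_contra h0
        exact h (hdvd τ (mem_support_iff.2 h0)))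
  have hcoeff : ∀ τ, coeff (τ + Finsupp.single z k) (X z ^ k * q) = coeff τ q := by
    intro τ
    rw [X_pow_eq_monomial, add_comm, coeff_monomial_mul, one_mul]
  have hq : q ∈ gradedPart (Fin n) K s := by
    rw [mem_gradedPart]
    intro τ hτ
    have h1 := mem_gradedPart.1 hpd (τ + Finsupp.single z k) (by rwa [hcoeff])
    rw [expDeg_eq_degree] at hdeg
    rw [map_add, map_add, hdeg] at h1
    push_cast at h1
    omega
  rw [monomial_mem_initialIdeal_iff hI]
  refine ⟨q, hinj q hq hp, by rw [← expDeg_eq_degree, hdeg]; exact hq, ?_, ?_⟩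
  · rw [mem_support_iff, ← hcoeff, ← mem_support_iff]
    exact hlead.1
  · intro τ hτ hne
    have := hlead.2 (τ + Finsupp.single z k)
      (by rw [mem_support_iff, hcoeff]; exact mem_support_iff.1 hτ) (by simpa using hne)
    rcases this with h | ⟨h, i, hi, hj⟩
    · left
      simp only [expDeg_add] at h
      omega
    · right
      simp only [expDeg_add] at h
      refine ⟨by omega, i, by simpa using hi, fun j hij => by simpa using hj j hij⟩

/-- If `x_n ^ k` is surjective from degree `s` to degree `s + k`, every standard monomial of degree
`s + k` is a multiple of `x_n ^ k`. -/
theorem exists_stdMon_of_mem_stdMon [Field K] {I : Ideal (MvPolynomial (Fin n) K)}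
    {z : Fin n} (hz : ∀ j, j ≤ z) {s k : ℕ}
    (hsurj : ∀ y ∈ gradedPart (Fin n) K (s + k),
      ∃ p ∈ gradedPart (Fin n) K s, y - X z ^ k * p ∈ I)
    {μ : Fin n →₀ ℕ} (hμ : μ ∈ stdMon I (s + k)) :
    ∃ ν ∈ stdMon I s, ν + Finsupp.single z k = μ := by
  obtain ⟨hdeg, hstd⟩ := hμ
  by_cases hle : Finsupp.single z k ≤ μ
  · obtain ⟨ν, rfl⟩ := exists_add_of_le hle
    rw [add_comm] at hstd hdeg ⊢
    refine ⟨ν, ⟨?_, stdMon_of_add hstd⟩, rfl⟩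
    rw [expDeg_add] at hdeg
    simp [expDeg_eq_degree] at hdeg ⊢
    omega
  · exfalso
    rw [Finsupp.single_le_iff, not_le] at hle
    obtain ⟨p, hp, hpI⟩ := hsurj (monomial μ 1) (by
      have := monomial_mem_gradedPart μ (1 : K)
      rw [← expDeg_eq_degree, hdeg] at this
      simpa using this)
    have hdvd : ∀ τ, coeff τ (X z ^ k * p) ≠ 0 → k ≤ τ z := by
      intro τ hτ
      rw [X_pow_eq_monomial, coeff_monomial_mul'] at hτ
      split_ifs at hτ with h
      · simpa using h
      · exact absurd rfl hτ
    have hlead : coeff μ (monomial μ 1 - X z ^ k * p) = 1 := by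
      rw [coeff_sub, coeff_monomial, if_pos rfl]
      by_cases h : coeff μ (X z ^ k * p) = 0
      · rw [h, sub_zero]
      · have := hdvd μ h
        omega
    apply hstd
    refine Ideal.subset_span ⟨_, hpI, ?_, μ, ⟨?_, ?_⟩, rfl⟩
    · intro h
      rw [h] at hlead
      simp at hlead
    · rw [mem_support_iff, hlead]
      exact one_ne_zero
    · intro τ hτ hne
      rw [mem_support_iff, coeff_sub, coeff_monomial, if_neg (Ne.symm hne), zero_sub,
        neg_ne_zero] at hτ
      right
      refine ⟨?_, z, hle.trans_le (hdvd τ hτ), fun j hj => absurd (hz j) (not_le.2 hj)⟩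
      have h1 := mem_gradedPart.1 (gradedPart_mul_mem
        (gradedPart_pow_mem (X_mem_gradedPart z) k) hp) τ hτ
      rw [hdeg, expDeg_eq_degree]
      omega

theorem stdMon_eq_image [Field K] {I : Ideal (MvPolynomial (Fin n) K)}
    (hI : ∀ (t : ℤ), ∀ p ∈ I, gradedComp t p ∈ I) {z : Fin n} (hz : ∀ j, j ≤ z) {c : ℤ}
    (hL : IsLefschetz I (X z) c) {s k : ℕ} (hsk : 2 * (s : ℤ) + k = c) :
    stdMon I (s + k) = (fun ν => ν + Finsupp.single z k) '' stdMon I s := by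
  ext μ
  constructor
  · exact exists_stdMon_of_mem_stdMon hz (hL.surj s k hsk)
  · rintro ⟨ν, hν, rfl⟩
    exact add_single_mem_stdMon hI hz (hL.inj s k hsk) hν

theorem stdMon_finite [CommRing K] (I : Ideal (MvPolynomial (Fin n) K)) (t : ℕ) :
    (stdMon I t).Finite :=
  (Finsupp.finite_of_degree_eq t).subset fun _ h => h.1

/-- The structure of the standard monomials in degrees above half the socle degree. -/
theorem stdMon_smallest_of_isLefschetz [Field K] {I : Ideal (MvPolynomial (Fin n) K)}
    (hI : ∀ (t : ℤ), ∀ p ∈ I, gradedComp t p ∈ I) {z : Fin n} (hz : ∀ j, j ≤ z) {δ : ℕ}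
    (hL : IsLefschetz I (X z) δ) {p q : ℕ} (hpq : p < q) (hp : δ ≤ 2 * p) (hq : q ≤ δ) :
    ∃ S ⊆ stdMon I p, S.ncard = (stdMon I q).ncard ∧
      (∀ s ∈ S, ∀ b ∈ stdMon I p \ S, DrlLT s b) ∧
      stdMon I q = (fun ν => ν + Finsupp.single z (q - p)) '' S := by
  obtain ⟨s, hs⟩ := Nat.exists_eq_add_of_le hq
  obtain ⟨r, hr⟩ : ∃ r, p = s + r := Nat.exists_eq_add_of_le (by omega)
  have hB : stdMon I q = (fun ν => ν + Finsupp.single z (r + (q - p))) '' stdMon I s := by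
    have := stdMon_eq_image hI hz hL (s := s) (k := r + (q - p)) (by omega)
    rwa [show s + (r + (q - p)) = q by omega] at this
  have hBS : stdMon I q = (fun ν => ν + Finsupp.single z (q - p)) ''
      ((fun ν => ν + Finsupp.single z r) '' stdMon I s) := by
    rw [hB, Set.image_image]
    simp only [add_assoc, ← Finsupp.single_add]
  refine ⟨(fun ν => ν + Finsupp.single z r) '' stdMon I s, ?_, ?_, ?_, hBS⟩
  · rintro _ ⟨ν, hν, rfl⟩
    have h1 : ν + Finsupp.single z r + Finsupp.single z (q - p) ∈ stdMon I q := by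
      rw [hBS]
      exact ⟨_, ⟨ν, hν, rfl⟩, rfl⟩
    refine ⟨?_, stdMon_of_add h1.2⟩
    rw [expDeg_add, hν.1, hr]
    simp [expDeg_eq_degree]
  · rw [hB, Set.ncard_image_of_injective _ (add_left_injective _),
      Set.ncard_image_of_injective _ (add_left_injective _)]
  · rintro _ ⟨ν, hν, rfl⟩ b ⟨hb, hbS⟩
    right
    refine ⟨?_, z, ?_, fun j hj => absurd (hz j) (not_le.2 hj)⟩
    · rw [hb.1, hr, expDeg_add, hν.1]
      simp [expDeg_eq_degree]
    · by_contra! hle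
      apply hbS
      have hrb : Finsupp.single z r ≤ b := by
        rw [Finsupp.single_le_iff]
        refine le_trans ?_ hle
        simp
      obtain ⟨τ, rfl⟩ := exists_add_of_le hrb
      rw [add_comm] at hb ⊢
      refine ⟨τ, ⟨?_, stdMon_of_add hb.2⟩, rfl⟩
      have := hb.1
      rw [expDeg_add, hr] at this
      simp [expDeg_eq_degree] at this ⊢
      omega

end StandardMonomials

/-! ### Toeplitz operators along Lefschetz strings -/

/-- Over an infinite field there is a sequence supported in `[0, d]` all of whose contiguous
Toeplitz minors (up to a given size) with diagonal in `[0, d]` are nonzero. -/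
theorem exists_toeplitz_det_ne_zero (K : Type*) [Field K] [Infinite K] (d N₀ : ℕ) :
    ∃ g : ℤ → K, (∀ e : ℤ, ¬ (0 ≤ e ∧ e ≤ d) → g e = 0) ∧
      ∀ e : ℤ, 0 ≤ e → e ≤ d → ∀ N ≤ N₀,
        (Matrix.of fun a b : Fin N => g (e + (a : ℕ) - (b : ℕ))).det ≠ 0 := by
  classical
  let G : ℤ → MvPolynomial ℤ K := fun e => if 0 ≤ e ∧ e ≤ d then X e else 0
  let A : ℤ → (N : ℕ) → Matrix (Fin N) (Fin N) (MvPolynomial ℤ K) :=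
    fun e N => Matrix.of fun a b => G (e + (a : ℕ) - (b : ℕ))
  have hA : ∀ e : ℤ, 0 ≤ e → e ≤ d → ∀ N, (A e N).det ≠ 0 := by
    intro e h0 h1 N h
    have h2 := congrArg (eval (Pi.single e (1 : K) : ℤ → K)) h
    rw [RingHom.map_det, map_zero] at h2
    have h3 : (eval (Pi.single e (1 : K) : ℤ → K)).mapMatrix (A e N) = 1 := by
      ext a b
      simp only [RingHom.mapMatrix_apply, Matrix.map_apply, A, G, Matrix.of_apply]
      by_cases hab : a = b
      · subst hab
        simp [h0, h1]
      · have hne : e + (a : ℕ) - (b : ℕ) ≠ e := by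
          intro h
          apply hab
          ext
          omega
        rw [Matrix.one_apply_ne hab]
        split_ifs
        · simp [hne]
        · simp
    rw [h3, Matrix.det_one] at h2
    exact one_ne_zero h2
  have hP : (∏ e ∈ Finset.range (d + 1), ∏ N ∈ Finset.range (N₀ + 1), (A e N).det) ≠ 0 := by
    refine Finset.prod_ne_zero_iff.2 fun e he => Finset.prod_ne_zero_iff.2 fun N _ => ?_
    refine hA e (by omega) ?_ N
    have := Finset.mem_range.1 he
    omega
  obtain ⟨x, hx⟩ : ∃ x : ℤ → K,
      eval x (∏ e ∈ Finset.range (d + 1), ∏ N ∈ Finset.range (N₀ + 1), (A e N).det) ≠ 0 := by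
    by_contra! h
    exact hP (MvPolynomial.funext fun x => by rw [h x, map_zero])
  refine ⟨fun e => eval x (G e), fun e he => by simp [G, he], fun e h0 h1 N hN => ?_⟩
  rw [map_prod] at hx
  have h2 := Finset.prod_ne_zero_iff.1 hx e.toNat (Finset.mem_range.2 (by omega))
  rw [map_prod] at h2
  have h3 := Finset.prod_ne_zero_iff.1 h2 N (Finset.mem_range.2 (by omega))
  rw [Int.toNat_of_nonneg h0, RingHom.map_det] at h3
  exact h3

theorem sum_Icc_int_eq_sum_fin {M : Type*} [AddCommMonoid M] (F : ℤ → M) (A B : ℤ) :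
    ∑ α ∈ Finset.Icc A B, F α = ∑ b : Fin (B - A + 1).toNat, F (A + (b : ℕ)) := by
  symm
  refine Finset.sum_bij (fun b _ => A + (b : ℕ)) ?_ ?_ ?_ ?_
  · intro b _
    rw [Finset.mem_Icc]
    omega
  · intro a _ b _ h
    ext
    omega
  · intro α hα
    rw [Finset.mem_Icc] at hα
    exact ⟨⟨(α - A).toNat, by omega⟩, Finset.mem_univ _, by simp only; omega⟩
  · intro _ _
    rfl

/-- A `ℤ`-graded family of subspaces with a degree one operator having the strong Lefschetz
property with respect to the center `c / 2`. -/
structure LefschetzOperator {K M : Type*} [Field K] [AddCommGroup M] [Module K M]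
    (V : ℤ → Submodule K M) (u : Module.End K M) (c : ℤ) : Prop where
  eq_zero_of_neg : ∀ t < 0, ∀ x ∈ V t, x = 0
  map_mem : ∀ t, ∀ x ∈ V t, u x ∈ V (t + 1)
  inj : ∀ (t : ℤ) (k : ℕ), 2 * t + k = c → ∀ x ∈ V t, (u ^ k) x = 0 → x = 0
  surj : ∀ (t : ℤ) (k : ℕ), 2 * t + k = c → ∀ y ∈ V (t + k), ∃ x ∈ V t, (u ^ k) x = y

namespace LefschetzOperator

variable {K M : Type*} [Field K] [AddCommGroup M] [Module K M] {V : ℤ → Submodule K M}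
  {u : Module.End K M} {c : ℤ}

theorem pow_map_mem (h : LefschetzOperator V u c) (k : ℕ) {t : ℤ} {x : M} (hx : x ∈ V t) :
    (u ^ k) x ∈ V (t + k) := by
  induction k with
  | zero => simpa using hx
  | succ k ih =>
    rw [pow_succ', Module.End.mul_apply]
    have := h.map_mem _ _ ih
    rwa [add_assoc, ← Nat.cast_succ] at this

theorem pow_injective (h : LefschetzOperator V u c) {t : ℤ} {m : ℕ} (hm : 2 * t + m ≤ c) {x : M}
    (hx : x ∈ V t) (h0 : (u ^ m) x = 0) : x = 0 := by
  refine h.inj t (c - 2 * t).toNat (by omega) x hx ?_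
  rw [show (c - 2 * t).toNat = ((c - 2 * t).toNat - m) + m by omega, pow_add,
    Module.End.mul_apply, h0, map_zero]

/-- The elements of degree `α` generated, under the operator, in degrees at most `r`. -/
def generatedBy (V : ℤ → Submodule K M) (u : Module.End K M) (r α : ℤ) : Submodule K M :=
  (V (α - (α - r).toNat)).map (u ^ (α - r).toNat)

theorem pow_mem_generatedBy (h : LefschetzOperator V u c) {r α : ℤ} {x : M}
    (hx : x ∈ generatedBy V u r α) (m : ℕ) : (u ^ m) x ∈ generatedBy V u r (α + m) := by
  obtain ⟨w, hw, rfl⟩ := hx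
  refine ⟨(u ^ ((α - r).toNat + m - (α + m - r).toNat)) w, ?_, ?_⟩
  · have := h.pow_map_mem ((α - r).toNat + m - (α + m - r).toNat) hw
    rw [SetLike.mem_coe]
    convert this using 2
    omega
  · rw [← Module.End.mul_apply, ← Module.End.mul_apply, ← pow_add, ← pow_add]
    congr 2
    omega

theorem mem_generatedBy_of_le {r α : ℤ} (hα : α ≤ r) {x : M} (hx : x ∈ V α) :
    x ∈ generatedBy V u r α := by
  refine ⟨x, ?_, ?_⟩ <;> simp [show (α - r).toNat = 0 by omega, hx]

theorem mem_generatedBy_of_ge (h : LefschetzOperator V u c) {r α : ℤ} (hα : c - r ≤ α) {x : M}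
    (hx : x ∈ V α) : x ∈ generatedBy V u r α := by
  rcases le_or_gt α r with hle | hlt
  · exact mem_generatedBy_of_le hle hx
  obtain ⟨y, hy, rfl⟩ := h.surj (c - α) (2 * α - c).toNat (by omega) x (by
    convert hx using 2
    omega)
  refine ⟨(u ^ (α - c + r).toNat) y, ?_, ?_⟩
  · have := h.pow_map_mem (α - c + r).toNat hy
    rw [SetLike.mem_coe]
    convert this using 2
    omega
  · rw [← Module.End.mul_apply, ← pow_add]
    congr 2
    omega

theorem eq_zero_of_mem_generatedBy (h : LefschetzOperator V u c) {r α : ℤ} (hr : r < 0) {x : M}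
    (hx : x ∈ generatedBy V u r α) : x = 0 := by
  obtain ⟨w, hw, rfl⟩ := hx
  rw [h.eq_zero_of_neg _ (by omega) w hw, map_zero]

theorem exists_of_mem_generatedBy {r α : ℤ} (hr : r ≤ α) {x : M}
    (hx : x ∈ generatedBy V u r α) : ∃ w ∈ V r, (u ^ (α - r).toNat) w = x := by
  obtain ⟨w, hw, rfl⟩ := hx
  refine ⟨w, ?_, rfl⟩
  have : α - (α - r).toNat = r := by omega
  rwa [SetLike.mem_coe, this] at hw

theorem mem_generatedBy_of_exists {r α : ℤ} (hr : r ≤ α) {w : M} (hw : w ∈ V r) :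
    (u ^ (α - r).toNat) w ∈ generatedBy V u r α := by
  refine ⟨w, ?_, rfl⟩
  have : α - (α - r).toNat = r := by omega
  rwa [SetLike.mem_coe, this]

theorem toeplitz_step (h : LefschetzOperator V u c) {d : ℕ} {g : ℤ → K}
    (hg : ∀ e : ℤ, ¬ (0 ≤ e ∧ e ≤ d) → g e = 0)
    (hdet : ∀ e : ℤ, 0 ≤ e → e ≤ d → ∀ N ≤ (c + 1).toNat,
      (Matrix.of fun a b : Fin N => g (e + (a : ℕ) - (b : ℕ))).det ≠ 0)
    {s : ℤ} {q : ℤ → M} 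
    (heq : ∀ β ∈ Finset.Icc (s + 1) (c - 1 - s + d),
      ∑ α ∈ Finset.Icc (s + 1 - d) (c - 1 - s), g (β - α) • (u ^ (β - α).toNat) (q α) = 0)
    (hq : ∀ α, q α ∈ V α) {r : ℤ} (hr : 0 ≤ r)
    (hqr : ∀ α ∈ Finset.Icc (s + 1 - d) (c - 1 - s), q α ∈ generatedBy V u r α) :
    ∀ α ∈ Finset.Icc (s + 1 - d) (c - 1 - s), q α ∈ generatedBy V u (r - 1) α := by
  have hout : ∀ α, ¬ (r ≤ α ∧ α ≤ c - r) → q α ∈ generatedBy V u (r - 1) α := by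
    intro α hα
    rcases lt_or_ge α r with h1 | h1
    · exact mem_generatedBy_of_le (by omega) (hq α)
    · exact h.mem_generatedBy_of_ge (by omega) (hq α)
  intro α₀ hα₀
  by_cases hin : r ≤ α₀ ∧ α₀ ≤ c - r
  swap
  · exact hout α₀ hin
  rw [Finset.mem_Icc] at hα₀
  set A₀ := max r (s + 1 - d) with hA₀
  set A₁ := min (c - r) (c - 1 - s) with hA₁
  set B₀ := max r (s + 1) with hB₀
  set N := (A₁ - A₀ + 1).toNat with hN
  have hw : ∀ b : Fin N, ∃ w ∈ V r, (u ^ (A₀ + (b : ℕ) - r).toNat) w = q (A₀ + (b : ℕ)) := by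
    intro b
    refine exists_of_mem_generatedBy (by omega) (hqr _ ?_)
    rw [Finset.mem_Icc]
    omega
  choose w hwV hwq using hw
  have hrow : ∀ a : Fin N, ∃ v ∈ V (r - 1),
      u v = ∑ b : Fin N, g (B₀ - A₀ + (a : ℕ) - (b : ℕ)) • w b := by
    intro a
    set β := B₀ + ((a : ℕ) : ℤ) with hβ
    have hsum := heq β (by rw [Finset.mem_Icc]; omega)
    have hsub : Finset.Icc A₀ A₁ ⊆ Finset.Icc (s + 1 - d) (c - 1 - s) :=
      Finset.Icc_subset_Icc (le_max_right _ _) (min_le_right _ _)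
    rw [← Finset.sum_sdiff hsub] at hsum
    have hrest : ∑ α ∈ Finset.Icc (s + 1 - d) (c - 1 - s) \ Finset.Icc A₀ A₁,
        g (β - α) • (u ^ (β - α).toNat) (q α) ∈ generatedBy V u (r - 1) β := by
      refine Submodule.sum_mem _ fun α hα => ?_
      rw [Finset.mem_sdiff, Finset.mem_Icc, Finset.mem_Icc] at hα
      rcases lt_or_ge β α with h1 | h1
      · rw [hg _ (by omega), zero_smul]
        exact Submodule.zero_mem _
      · refine Submodule.smul_mem _ _ ?_
        have := h.pow_mem_generatedBy (hout α (by omega)) (β - α).toNat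
        convert this using 2
        omega
    have hmain : ∑ α ∈ Finset.Icc A₀ A₁, g (β - α) • (u ^ (β - α).toNat) (q α) =
        (u ^ (β - r).toNat) (∑ b : Fin N, g (B₀ - A₀ + (a : ℕ) - (b : ℕ)) • w b) := by
      rw [sum_Icc_int_eq_sum_fin, map_sum]
      refine Finset.sum_congr rfl fun b _ => ?_
      rw [map_smul, show β - (A₀ + ((b : ℕ) : ℤ)) = B₀ - A₀ + (a : ℕ) - (b : ℕ) by omega]
      rcases lt_or_ge (B₀ - A₀ + (a : ℕ) - (b : ℕ) : ℤ) 0 with h1 | h1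
      · rw [hg _ (by omega), zero_smul, zero_smul]
      · rw [← hwq b, ← Module.End.mul_apply, ← pow_add]
        congr 3
        omega
    rw [hmain] at hsum
    have hmem : (u ^ (β - r).toNat) (∑ b : Fin N, g (B₀ - A₀ + (a : ℕ) - (b : ℕ)) • w b) ∈
        generatedBy V u (r - 1) β := by
      rw [eq_neg_of_add_eq_zero_right hsum]
      exact Submodule.neg_mem _ hrest
    obtain ⟨v, hv, hv'⟩ := exists_of_mem_generatedBy (by omega) hmem
    refine ⟨v, hv, ?_⟩
    rw [← sub_eq_zero]
    refine h.pow_injective (t := r) (m := (β - r).toNat) (by omega) ?_ ?_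
    · refine Submodule.sub_mem _ ?_ (Submodule.sum_mem _ fun b _ => Submodule.smul_mem _ _ (hwV b))
      have := h.map_mem _ _ hv
      rwa [sub_add_cancel] at this
    · rw [map_sub, ← hv', ← Module.End.mul_apply, ← pow_succ,
        show (β - r).toNat + 1 = (β - (r - 1)).toNat by omega, sub_self]
  choose v hvV hv using hrow
  have hD := hdet (B₀ - A₀) (by omega) (by omega) N (by omega)
  set T : Matrix (Fin N) (Fin N) K :=
    Matrix.of fun a b : Fin N => g (B₀ - A₀ + (a : ℕ) - (b : ℕ)) with hT
  have hwu : ∀ b, w b = u (∑ a, T⁻¹ b a • v a) := by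
    intro b
    rw [map_sum]
    simp_rw [map_smul, hv, Finset.smul_sum, smul_smul]
    rw [Finset.sum_comm]
    simp_rw [← Finset.sum_smul]
    have h1 : ∀ x : Fin N, ∑ a, T⁻¹ b a * g (B₀ - A₀ + (a : ℕ) - (x : ℕ)) =
        (1 : Matrix (Fin N) (Fin N) K) b x := by
      intro x
      rw [← Matrix.nonsing_inv_mul T (isUnit_iff_ne_zero.2 hD), Matrix.mul_apply]
      rfl
    simp_rw [h1, Matrix.one_apply, ite_smul, one_smul, zero_smul]
    simp
  obtain ⟨b, hb⟩ : ∃ b : Fin N, α₀ = A₀ + (b : ℕ) :=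
    ⟨⟨(α₀ - A₀).toNat, by omega⟩, by simp only; omega⟩
  rw [hb, ← hwq b, hwu b, ← Module.End.mul_apply, ← pow_succ,
    show (A₀ + (b : ℕ) - r).toNat + 1 = (A₀ + (b : ℕ) - (r - 1)).toNat by omega]
  exact mem_generatedBy_of_exists (by omega)
    (Submodule.sum_mem _ fun a _ => Submodule.smul_mem _ _ (hvV a))

/-- Injectivity of the Toeplitz operator with symbol `g`. -/
theorem toeplitz_injective (h : LefschetzOperator V u c) {d : ℕ} {g : ℤ → K}
    (hg : ∀ e : ℤ, ¬ (0 ≤ e ∧ e ≤ d) → g e = 0)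
    (hdet : ∀ e : ℤ, 0 ≤ e → e ≤ d → ∀ N ≤ (c + 1).toNat,
      (Matrix.of fun a b : Fin N => g (e + (a : ℕ) - (b : ℕ))).det ≠ 0)
    {s : ℤ} {q : ℤ → M} (hq : ∀ α, q α ∈ V α)
    (heq : ∀ β ∈ Finset.Icc (s + 1) (c - 1 - s + d),
      ∑ α ∈ Finset.Icc (s + 1 - d) (c - 1 - s), g (β - α) • (u ^ (β - α).toNat) (q α) = 0) :
    ∀ α ∈ Finset.Icc (s + 1 - d) (c - 1 - s), q α = 0 := by
  have key : ∀ m : ℕ, m ≤ c.toNat + 2 → ∀ α ∈ Finset.Icc (s + 1 - d) (c - 1 - s),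
      q α ∈ generatedBy V u (c.toNat + 1 - m) α := by
    intro m
    induction m with
    | zero =>
      intro _ α _
      rcases le_or_gt α (c.toNat + 1) with h1 | h1
      · exact mem_generatedBy_of_le (by omega) (hq α)
      · exact h.mem_generatedBy_of_ge (by omega) (hq α)
    | succ m ih =>
      intro hm
      have := h.toeplitz_step hg hdet heq hq (by omega) (ih (by omega))
      rwa [show (c.toNat : ℤ) + 1 - m - 1 = c.toNat + 1 - ((m + 1 : ℕ) : ℤ) by push_cast; ring]
        at this
  intro α hα
  exact h.eq_zero_of_mem_generatedBy (by omega) (key (c.toNat + 2) le_rfl α hα)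

theorem finrank_eq_of_le (h : LefschetzOperator V u c) {t : ℤ} (ht : 2 * t ≤ c) :
    Module.finrank K (V t) = Module.finrank K (V (c - t)) := by
  have hk : c - t = t + (c - 2 * t).toNat := by omega
  rw [hk]
  refine LinearEquiv.finrank_eq (LinearEquiv.ofBijective
    ((u ^ (c - 2 * t).toNat).restrict fun x hx => h.pow_map_mem _ hx) ⟨?_, ?_⟩)
  · rw [← LinearMap.ker_eq_bot, LinearMap.ker_eq_bot']
    intro x hx
    ext
    exact h.inj t _ (by omega) x x.2 (congrArg Subtype.val hx)
  · intro y
    obtain ⟨x, hx, hxy⟩ := h.surj t (c - 2 * t).toNat (by omega) y y.2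
    exact ⟨⟨x, hx⟩, Subtype.ext hxy⟩

theorem finrank_eq (h : LefschetzOperator V u c) (t : ℤ) :
    Module.finrank K (V t) = Module.finrank K (V (c - t)) := by
  rcases le_or_gt (2 * t) c with h1 | h1
  · exact h.finrank_eq_of_le h1
  · have := h.finrank_eq_of_le (t := c - t) (by omega)
    rw [sub_sub_cancel] at this
    exact this.symm

/-- Surjectivity of the Toeplitz operator with symbol `g`. -/
theorem toeplitz_surjective (h : LefschetzOperator V u c) [∀ t, FiniteDimensional K (V t)]
    {d : ℕ} {g : ℤ → K} (hg : ∀ e : ℤ, ¬ (0 ≤ e ∧ e ≤ d) → g e = 0)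
    (hdet : ∀ e : ℤ, 0 ≤ e → e ≤ d → ∀ N ≤ (c + 1).toNat,
      (Matrix.of fun a b : Fin N => g (e + (a : ℕ) - (b : ℕ))).det ≠ 0)
    {s : ℤ} {y : ℤ → M} (hy : ∀ β, y β ∈ V β) :
    ∃ q : ℤ → M, (∀ α, q α ∈ V α) ∧ ∀ β ∈ Finset.Icc (s + 1) (c - 1 - s + d),
      ∑ α ∈ Finset.Icc (s + 1 - d) (c - 1 - s), g (β - α) • (u ^ (β - α).toNat) (q α) = y β := by
  classical
  set I := Finset.Icc (s + 1 - d) (c - 1 - s) with hI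
  set J := Finset.Icc (s + 1) (c - 1 - s + d) with hJ
  let T : (Π α : I, V α) →ₗ[K] (Π β : J, V β) := LinearMap.pi fun β =>
    LinearMap.codRestrict (V β) (∑ α : I, g (β - α) • ((u ^ (β - α : ℤ).toNat) ∘ₗ
      (V α).subtype ∘ₗ LinearMap.proj α)) (by
        intro x
        rw [LinearMap.sum_apply]
        refine Submodule.sum_mem _ fun α _ => ?_
        rw [LinearMap.smul_apply]
        rcases lt_or_ge (β - α : ℤ) 0 with h1 | h1
        · rw [hg _ (by omega), zero_smul]
          exact Submodule.zero_mem _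
        · refine Submodule.smul_mem _ _ ?_
          have := h.pow_map_mem (β - α : ℤ).toNat (x α).2
          rwa [show (α : ℤ) + (β - α : ℤ).toNat = β by omega] at this)
  have hT : ∀ x (β : J), ((T x β : V β) : M) =
      ∑ α : I, g (β - α) • (u ^ (β - α : ℤ).toNat) (x α : M) := by
    intro x β
    simp [T]
  let ext0 : (Π α : I, V α) → ℤ → M := fun x α => if hα : α ∈ I then x ⟨α, hα⟩ else 0
  have hext : ∀ x α, ext0 x α ∈ V α := by
    intro x α
    simp only [ext0]
    split_ifs with hα
    · exact (x ⟨α, hα⟩).2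
    · exact Submodule.zero_mem _
  have hText : ∀ x (β : J), ((T x β : V β) : M) =
      ∑ α ∈ I, g (β - α) • (u ^ (β - α : ℤ).toNat) (ext0 x α) := by
    intro x β
    rw [hT, ← Finset.sum_attach I, Finset.univ_eq_attach]
    refine Finset.sum_congr rfl fun α _ => ?_
    simp [ext0]
  have hinj : Function.Injective T := by
    rw [← LinearMap.ker_eq_bot, LinearMap.ker_eq_bot']
    intro x hx
    ext α
    have := h.toeplitz_injective hg hdet (s := s) (hext x) (fun β hβ => by
      rw [← hText x ⟨β, hβ⟩, hx]
      rfl) α α.2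
    simpa [ext0] using this
  have hdim : Module.finrank K (Π α : I, V α) = Module.finrank K (Π β : J, V β) := by
    rw [Module.finrank_pi_fintype, Module.finrank_pi_fintype,
      Finset.sum_coe_sort I fun α => Module.finrank K (V α),
      Finset.sum_coe_sort J fun β => Module.finrank K (V β)]
    refine Finset.sum_bij (fun α _ => c - α) ?_ ?_ ?_ fun α _ => h.finrank_eq α
    · intro α hα
      rw [hI, Finset.mem_Icc] at hα
      rw [hJ, Finset.mem_Icc]
      omega
    · intro α _ β _ hαβ
      omega
    · intro β hβ
      rw [hJ, Finset.mem_Icc] at hβ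
      exact ⟨c - β, by rw [hI, Finset.mem_Icc]; omega, by omega⟩
  obtain ⟨x, hx⟩ := (LinearMap.injective_iff_surjective_of_finrank_eq_finrank hdim).1 hinj
    fun β => ⟨y β, hy β⟩
  refine ⟨ext0 x, hext x, fun β hβ => ?_⟩
  rw [← hText x ⟨β, hβ⟩, hx]

end LefschetzOperator

/-! ### Adjoining a variable to a Lefschetz quotient -/

section AdjoinVariable

variable {σ K : Type*} [Field K]

/-- The image of the forms of degree `t` in the quotient by `J`. -/
noncomputable def quotPart (J : Ideal (MvPolynomial σ K)) (t : ℤ) :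
    Submodule K (MvPolynomial σ K ⧸ J) :=
  (gradedPart σ K t).map (Ideal.Quotient.mkₐ K J).toLinearMap

theorem mem_quotPart {J : Ideal (MvPolynomial σ K)} {t : ℤ} {x : MvPolynomial σ K ⧸ J} :
    x ∈ quotPart J t ↔ ∃ p ∈ gradedPart σ K t, Ideal.Quotient.mk J p = x :=
  Iff.rfl

theorem mulLeft_pow_mk (J : Ideal (MvPolynomial σ K)) (l p : MvPolynomial σ K) (k : ℕ) :
    (LinearMap.mulLeft K (Ideal.Quotient.mk J l) ^ k) (Ideal.Quotient.mk J p) =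
      Ideal.Quotient.mk J (l ^ k * p) := by
  rw [LinearMap.pow_mulLeft, LinearMap.mulLeft_apply, map_mul, map_pow]

theorem IsLefschetz.lefschetzOperator {J : Ideal (MvPolynomial σ K)} {l : MvPolynomial σ K}
    {c : ℤ} (h : IsLefschetz J l c) (hl : l ∈ gradedPart σ K 1) :
    LefschetzOperator (quotPart J) (LinearMap.mulLeft K (Ideal.Quotient.mk J l)) c where
  eq_zero_of_neg := by
    rintro t ht x hx
    obtain ⟨p, hp, rfl⟩ := mem_quotPart.1 hx
    rw [gradedPart_eq_zero_of_neg ht hp, map_zero]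
  map_mem := by
    rintro t x hx
    obtain ⟨p, hp, rfl⟩ := mem_quotPart.1 hx
    refine mem_quotPart.2 ⟨l * p, ?_, by rw [LinearMap.mulLeft_apply, map_mul]⟩
    rw [add_comm]
    exact gradedPart_mul_mem hl hp
  inj := by
    rintro t k hk x hx h0
    obtain ⟨p, hp, rfl⟩ := mem_quotPart.1 hx
    rw [mulLeft_pow_mk, Ideal.Quotient.eq_zero_iff_mem] at h0
    exact Ideal.Quotient.eq_zero_iff_mem.2 (h.inj t k hk p hp h0)
  surj := by
    rintro t k hk y hy
    obtain ⟨q, hq, rfl⟩ := mem_quotPart.1 hy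
    obtain ⟨p, hp, hpq⟩ := h.surj t k hk q hq
    refine ⟨Ideal.Quotient.mk J p, mem_quotPart.2 ⟨p, hp, rfl⟩, ?_⟩
    rw [mulLeft_pow_mk]
    exact (Ideal.Quotient.eq.2 hpq).symm

theorem gradedPart_eq_span (t : ℤ) : gradedPart σ K t = Submodule.span K
    (Set.range fun μ : {μ : σ →₀ ℕ // (μ.degree : ℤ) = t} => monomial μ.1 (1 : K)) := by
  apply le_antisymm
  · intro p hp
    rw [p.as_sum]
    refine Submodule.sum_mem _ fun μ hμ => ?_
    rw [← mul_one (coeff μ p), ← smul_eq_mul, ← smul_monomial]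
    exact Submodule.smul_mem _ _ (Submodule.subset_span
      ⟨⟨μ, mem_gradedPart.1 hp μ (mem_support_iff.1 hμ)⟩, rfl⟩)
  · rw [Submodule.span_le]
    rintro _ ⟨μ, rfl⟩
    have := monomial_mem_gradedPart μ.1 (1 : K)
    rwa [μ.2] at this

instance finite_exponents_of_degree [Finite σ] (t : ℤ) :
    Finite {μ : σ →₀ ℕ // (μ.degree : ℤ) = t} := by
  have hsub : {μ : σ →₀ ℕ | (μ.degree : ℤ) = t} ⊆ {μ : σ →₀ ℕ | μ.degree = t.toNat} := by
    intro μ (hμ : (μ.degree : ℤ) = t)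
    change μ.degree = t.toNat
    omega
  exact ((Finsupp.finite_of_degree_eq t.toNat).subset hsub).to_subtype

instance finiteDimensional_gradedPart [Finite σ] (t : ℤ) :
    FiniteDimensional K (gradedPart σ K t) := by
  rw [gradedPart_eq_span]
  exact FiniteDimensional.span_of_finite K (Set.finite_range _)

instance finiteDimensional_quotPart [Finite σ] (J : Ideal (MvPolynomial σ K)) (t : ℤ) :
    FiniteDimensional K (quotPart J t) := by
  rw [quotPart]
  infer_instance

/-- Polynomials over a polynomial ring that are homogeneous of total degree `t`. -/
def IsPolyGraded (t : ℤ) (P : Polynomial (MvPolynomial σ K)) : Prop :=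
  ∀ m : ℕ, P.coeff m ∈ gradedPart σ K (t - m)

theorem IsPolyGraded.mul {s t : ℤ} {P Q : Polynomial (MvPolynomial σ K)} (hP : IsPolyGraded s P)
    (hQ : IsPolyGraded t Q) : IsPolyGraded (s + t) (P * Q) := by
  intro m
  rw [Polynomial.coeff_mul]
  refine Submodule.sum_mem _ fun x hx => ?_
  rw [Finset.HasAntidiagonal.mem_antidiagonal] at hx
  have := gradedPart_mul_mem (hP x.1) (hQ x.2)
  rwa [show s - x.1 + (t - x.2) = s + t - m by omega] at this

theorem IsPolyGraded.sub {t : ℤ} {P Q : Polynomial (MvPolynomial σ K)} (hP : IsPolyGraded t P)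
    (hQ : IsPolyGraded t Q) : IsPolyGraded t (P - Q) := by
  intro m
  rw [Polynomial.coeff_sub]
  exact Submodule.sub_mem _ (hP m) (hQ m)

/-- The form of degree `d` in `l` and the new variable with coefficient sequence `g`. -/
noncomputable def toeplitzForm (g : ℤ → K) (l : MvPolynomial σ K) (d : ℕ) :
    Polynomial (MvPolynomial σ K) :=
  ∑ m ∈ Finset.range (d + 1),
    Polynomial.C (g ((d : ℤ) - m) • l ^ ((d : ℤ) - m).toNat) * Polynomial.X ^ m

variable {g : ℤ → K} {l : MvPolynomial σ K} {d : ℕ}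

theorem coeff_toeplitzForm (hg : ∀ e : ℤ, ¬ (0 ≤ e ∧ e ≤ d) → g e = 0) (m : ℕ) :
    (toeplitzForm g l d).coeff m = g ((d : ℤ) - m) • l ^ ((d : ℤ) - m).toNat := by
  simp only [toeplitzForm, Polynomial.finsetSum_coeff, Polynomial.coeff_C_mul_X_pow]
  rw [Finset.sum_ite_eq]
  split_ifs with h
  · rfl
  · rw [Finset.mem_range] at h
    rw [hg _ (by omega), zero_smul]

theorem isPolyGraded_toeplitzForm (hg : ∀ e : ℤ, ¬ (0 ≤ e ∧ e ≤ d) → g e = 0)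
    (hl : l ∈ gradedPart σ K 1) : IsPolyGraded d (toeplitzForm g l d) := by
  intro m
  rw [coeff_toeplitzForm hg]
  rcases lt_or_ge ((d : ℤ) - m) 0 with h | h
  · rw [hg _ (by omega), zero_smul]
    exact Submodule.zero_mem _
  · have := gradedPart_pow_mem hl ((d : ℤ) - m).toNat
    rw [Int.toNat_of_nonneg h] at this
    exact Submodule.smul_mem _ _ this

theorem mem_polynomial_map_C_iff {J : Ideal (MvPolynomial σ K)} {P : Polynomial (MvPolynomial σ K)} :
    P ∈ J.map Polynomial.C ↔ ∀ m, P.coeff m ∈ J :=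
  Ideal.mem_map_C_iff

theorem mem_map_C_of_X_pow_mul_mem {J : Ideal (MvPolynomial σ K)} {P : Polynomial (MvPolynomial σ K)}
    {k : ℕ} (h : Polynomial.X ^ k * P ∈ J.map Polynomial.C) : P ∈ J.map Polynomial.C := by
  rw [mem_polynomial_map_C_iff] at h ⊢
  intro m
  have := h (m + k)
  rwa [Polynomial.coeff_X_pow_mul] at this

theorem coeff_toeplitzForm_mul (hg : ∀ e : ℤ, ¬ (0 ≤ e ∧ e ≤ d) → g e = 0)
    (Q : Polynomial (MvPolynomial σ K)) {m k : ℕ} (hm : m < k) :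
    (toeplitzForm g l d * Q).coeff m =
      ∑ j ∈ Finset.range k, g ((d : ℤ) - m + j) • (l ^ ((d : ℤ) - m + j).toNat * Q.coeff j) := by
  rw [mul_comm, Polynomial.coeff_mul, Finset.Nat.sum_antidiagonal_eq_sum_range_succ_mk]
  rw [← Finset.sum_subset (Finset.range_subset_range.2 (Nat.succ_le_of_lt hm))]
  · refine Finset.sum_congr rfl fun j hj => ?_
    rw [Finset.mem_range] at hj
    rw [coeff_toeplitzForm hg, show (d : ℤ) - ((m - j : ℕ) : ℤ) = d - m + j by omega,
      mul_comm, smul_mul_assoc]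
  · intro j _ hj
    rw [Finset.mem_range] at hj
    rw [hg _ (by omega), zero_smul]

/-- The low coefficients of a multiple of `toeplitzForm` are given by a Toeplitz operator. -/
theorem sum_toeplitz_eq_mk_coeff (hg : ∀ e : ℤ, ¬ (0 ≤ e ∧ e ≤ d) → g e = 0)
    (J : Ideal (MvPolynomial σ K)) {c s : ℤ} {k : ℕ} (hk : 2 * s + k = c + d - 1)
    {q : ℤ → MvPolynomial σ K ⧸ J} {Q : Polynomial (MvPolynomial σ K)}
    (hqQ : ∀ j < k, q (c - 1 - s - j) = Ideal.Quotient.mk J (Q.coeff j)) {m : ℕ} (hm : m < k) :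
    ∑ α ∈ Finset.Icc (s + 1 - d) (c - 1 - s), g (s + k - m - α) •
      (LinearMap.mulLeft K (Ideal.Quotient.mk J l) ^ (s + k - m - α).toNat) (q α) =
        Ideal.Quotient.mk J ((toeplitzForm g l d * Q).coeff m) := by
  rw [coeff_toeplitzForm_mul hg Q hm, map_sum]
  symm
  refine Finset.sum_bij (fun j _ => c - 1 - s - j) ?_ ?_ ?_ ?_
  · intro j hj
    rw [Finset.mem_range] at hj
    rw [Finset.mem_Icc]
    omega
  · intro a _ b _ hab
    omega
  · intro α hα
    rw [Finset.mem_Icc] at hα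
    exact ⟨(c - 1 - s - α).toNat, by rw [Finset.mem_range]; omega, by omega⟩
  · intro j hj
    rw [Finset.mem_range] at hj
    rw [hqQ j hj, mulLeft_pow_mk, show s + k - m - (c - 1 - s - j) = d - m + j by omega]
    exact map_smul (Ideal.Quotient.mkₐ K J) _ _

variable {J : Ideal (MvPolynomial σ K)} {c : ℤ}

theorem exists_of_X_pow_mul_sub_mem (h : IsLefschetz J l c) (hl : l ∈ gradedPart σ K 1)
    (hg : ∀ e : ℤ, ¬ (0 ≤ e ∧ e ≤ d) → g e = 0)
    (hdet : ∀ e : ℤ, 0 ≤ e → e ≤ d → ∀ N ≤ (c + 1).toNat,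
      (Matrix.of fun a b : Fin N => g (e + (a : ℕ) - (b : ℕ))).det ≠ 0)
    {s : ℤ} {k : ℕ} (hk : 2 * s + k = c + d - 1) {P Q : Polynomial (MvPolynomial σ K)}
    (hQ : IsPolyGraded (s + k - d) Q)
    (hPQ : Polynomial.X ^ k * P - toeplitzForm g l d * Q ∈ J.map Polynomial.C) :
    ∃ Q', P - toeplitzForm g l d * Q' ∈ J.map Polynomial.C := by
  have hQJ : ∀ j < k, Q.coeff j ∈ J := by
    intro j hj
    have hzero := (h.lefschetzOperator hl).toeplitz_injective hg hdet (s := s)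
      (q := fun α => if α ≤ c - 1 - s then
        Ideal.Quotient.mk J (Q.coeff (c - 1 - s - α).toNat) else 0) ?_ ?_ (c - 1 - s - j) ?_
    · rw [if_pos (by omega), show (c - 1 - s - (c - 1 - s - j)).toNat = j by omega,
        Ideal.Quotient.eq_zero_iff_mem] at hzero
      exact hzero
    · intro α
      split_ifs with hα
      · refine mem_quotPart.2 ⟨_, ?_, rfl⟩
        have := hQ (c - 1 - s - α).toNat
        rwa [show s + k - d - (c - 1 - s - α).toNat = α by omega] at this
      · exact Submodule.zero_mem _
    · intro β hβ
      rw [Finset.mem_Icc] at hβ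
      have hm : (s + k - β).toNat < k := by omega
      have := sum_toeplitz_eq_mk_coeff (l := l) hg J hk (q := fun α => if α ≤ c - 1 - s then
        Ideal.Quotient.mk J (Q.coeff (c - 1 - s - α).toNat) else 0) (Q := Q) (fun j _ => by
          rw [if_pos (by omega), show (c - 1 - s - (c - 1 - s - j)).toNat = j by omega]) hm
      rw [show s + k - ((s + k - β).toNat : ℤ) = β by omega] at this
      rw [this, Ideal.Quotient.eq_zero_iff_mem]
      have h2 := mem_polynomial_map_C_iff.1 hPQ (s + k - β).toNat
      rw [Polynomial.coeff_sub, Polynomial.coeff_X_pow_mul', if_neg (by omega), zero_sub] at h2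
      exact J.neg_mem_iff.1 h2
    · rw [Finset.mem_Icc]
      omega
  obtain ⟨Q', hQ'⟩ : ∃ Q', Q - Polynomial.X ^ k * Q' ∈ J.map Polynomial.C := by
    refine ⟨Polynomial.divX^[k] Q, mem_polynomial_map_C_iff.2 fun m => ?_⟩
    have hiter : ∀ (k m : ℕ) (Q : Polynomial (MvPolynomial σ K)),
        (Polynomial.divX^[k] Q).coeff m = Q.coeff (m + k) := by
      intro k
      induction k with
      | zero => simp
      | succ k ih =>
        intro m Q
        rw [Function.iterate_succ_apply, ih, Polynomial.coeff_divX, add_assoc]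
    rw [Polynomial.coeff_sub, Polynomial.coeff_X_pow_mul', hiter]
    split_ifs with hkm
    · rw [Nat.sub_add_cancel hkm, sub_self]
      exact J.zero_mem
    · rw [sub_zero]
      exact hQJ m (by omega)
  refine ⟨Q', mem_map_C_of_X_pow_mul_mem (k := k) ?_⟩
  have : Polynomial.X ^ k * (P - toeplitzForm g l d * Q') =
      (Polynomial.X ^ k * P - toeplitzForm g l d * Q) +
        toeplitzForm g l d * (Q - Polynomial.X ^ k * Q') := by ring
  rw [this]
  exact Ideal.add_mem _ hPQ (Ideal.mul_mem_left _ _ hQ')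

theorem exists_sub_X_pow_mul_sub_mem [Finite σ] (h : IsLefschetz J l c)
    (hl : l ∈ gradedPart σ K 1)
    (hg : ∀ e : ℤ, ¬ (0 ≤ e ∧ e ≤ d) → g e = 0)
    (hdet : ∀ e : ℤ, 0 ≤ e → e ≤ d → ∀ N ≤ (c + 1).toNat,
      (Matrix.of fun a b : Fin N => g (e + (a : ℕ) - (b : ℕ))).det ≠ 0)
    {s : ℤ} {k : ℕ} (hk : 2 * s + k = c + d - 1) {Y : Polynomial (MvPolynomial σ K)}
    (hY : IsPolyGraded (s + k) Y) :
    ∃ P Q, IsPolyGraded s P ∧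
      Y - Polynomial.X ^ k * P - toeplitzForm g l d * Q ∈ J.map Polynomial.C := by
  obtain ⟨q, hqV, hq⟩ := (h.lefschetzOperator hl).toeplitz_surjective hg hdet (s := s)
    (y := fun β => if β ≤ s + k then Ideal.Quotient.mk J (Y.coeff (s + k - β).toNat) else 0) (by
      intro β
      split_ifs with hβ
      · refine mem_quotPart.2 ⟨_, ?_, rfl⟩
        have := hY (s + k - β).toNat
        rwa [show s + k - ((s + k - β).toNat : ℤ) = β by omega] at this
      · exact Submodule.zero_mem _)
  choose L hL hLq using fun α => mem_quotPart.1 (hqV α)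
  set Q : Polynomial (MvPolynomial σ K) :=
    ∑ j ∈ Finset.range k, Polynomial.C (L (c - 1 - s - j)) * Polynomial.X ^ j with hQ
  have hQcoeff : ∀ j, Q.coeff j = if j < k then L (c - 1 - s - j) else 0 := by
    intro j
    simp only [hQ, Polynomial.finsetSum_coeff, Polynomial.coeff_C_mul_X_pow]
    rw [Finset.sum_ite_eq]
    simp only [Finset.mem_range]
  have hQgr : IsPolyGraded (s + k - d) Q := by
    intro j
    rw [hQcoeff]
    split_ifs
    · rw [show s + k - d - j = c - 1 - s - j by omega]
      exact hL _
    · exact Submodule.zero_mem _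
  have hYQ : IsPolyGraded (s + k) (Y - toeplitzForm g l d * Q) := by
    refine hY.sub ?_
    have := (isPolyGraded_toeplitzForm hg hl).mul hQgr
    rwa [show (d : ℤ) + (s + k - d) = s + k by ring] at this
  set W := Y - toeplitzForm g l d * Q with hW
  have hlow : ∀ m < k, W.coeff m ∈ J := by
    intro m hm
    rw [hW, Polynomial.coeff_sub, ← Ideal.Quotient.eq,
      ← sum_toeplitz_eq_mk_coeff hg J hk (q := q) (fun j hj => by rw [hQcoeff, if_pos hj, hLq]) hm,
      hq _ (by rw [Finset.mem_Icc]; omega), if_pos (by omega),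
      show (s + k - (s + k - m)).toNat = m by omega]
  refine ⟨∑ m ∈ Finset.range (W.natDegree + 1), Polynomial.C (W.coeff (m + k)) * Polynomial.X ^ m,
    Q, ?_, ?_⟩
  · intro m
    simp only [Polynomial.finsetSum_coeff, Polynomial.coeff_C_mul_X_pow]
    rw [Finset.sum_ite_eq]
    split_ifs
    · have := hYQ (m + k)
      rwa [show s + k - ((m + k : ℕ) : ℤ) = s - m by push_cast; ring] at this
    · exact Submodule.zero_mem _
  · refine mem_polynomial_map_C_iff.2 fun m => ?_
    rw [sub_right_comm, ← hW, Polynomial.coeff_sub, Polynomial.coeff_X_pow_mul']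
    split_ifs with hkm
    · simp only [Polynomial.finsetSum_coeff, Polynomial.coeff_C_mul_X_pow]
      rw [Finset.sum_ite_eq, Nat.sub_add_cancel hkm]
      split_ifs with h2
      · rw [sub_self]
        exact J.zero_mem
      · rw [Finset.mem_range] at h2
        rw [Polynomial.coeff_eq_zero_of_natDegree_lt (by omega), sub_zero]
        exact J.zero_mem
    · rw [sub_zero]
      exact hlow m (by omega)

theorem mem_of_mul_toeplitzForm_mem (hg : ∀ e : ℤ, ¬ (0 ≤ e ∧ e ≤ d) → g e = 0) (hg0 : g 0 ≠ 0)
    {Q : Polynomial (MvPolynomial σ K)} (hQ : Q * toeplitzForm g l d ∈ J.map Polynomial.C) :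
    Q ∈ J.map Polynomial.C := by
  have hmap : ∀ P : Polynomial (MvPolynomial σ K),
      P ∈ J.map Polynomial.C ↔ P.map (Ideal.Quotient.mk J) = 0 := by
    intro P
    rw [mem_polynomial_map_C_iff, Polynomial.ext_iff]
    simp [Ideal.Quotient.eq_zero_iff_mem]
  have hmonic : ((Polynomial.C (C (g 0)⁻¹) * toeplitzForm g l d).map
      (Ideal.Quotient.mk J)).Monic := by
    refine Polynomial.Monic.map _ (Polynomial.monic_of_natDegree_le_of_coeff_eq_one d ?_ ?_)
    · refine Polynomial.natDegree_le_iff_coeff_eq_zero.2 fun m hm => ?_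
      rw [Polynomial.coeff_C_mul, coeff_toeplitzForm hg, hg ((d : ℤ) - m) (by omega), zero_smul,
        mul_zero]
    · rw [Polynomial.coeff_C_mul, coeff_toeplitzForm hg]
      simp [smul_eq_C_mul, ← C_mul, hg0]
  have h1 : Q * (Polynomial.C (C (g 0)⁻¹) * toeplitzForm g l d) ∈ J.map Polynomial.C := by
    rw [mul_left_comm]
    exact Ideal.mul_mem_left _ _ hQ
  rw [hmap, Polynomial.map_mul] at h1
  rw [hmap]
  exact hmonic.mul_left_eq_zero_iff.1 h1

end AdjoinVariable

/-! ### Koszul syzygies -/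

section Koszul

variable {R S ι : Type*} [CommRing R] [CommRing S]

/-- The submodule generated by the Koszul syzygies of `f`. -/
def koszulSyzygies [DecidableEq ι] (f : ι → R) : Submodule R (ι → R) :=
  Submodule.span R (Set.range fun p : ι × ι => Pi.single p.1 (f p.2) - Pi.single p.2 (f p.1))

/-- Every syzygy of `f` is a combination of Koszul syzygies. -/
def IsKoszul [Fintype ι] [DecidableEq ι] (f : ι → R) : Prop :=
  ∀ G : ι → R, ∑ i, G i * f i = 0 → G ∈ koszulSyzygies f

theorem map_mem_koszulSyzygies [DecidableEq ι] (φ : R →+* S) {f G : ι → R}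
    (hG : G ∈ koszulSyzygies f) : (fun i => φ (G i)) ∈ koszulSyzygies fun i => φ (f i) := by
  induction hG using Submodule.span_induction with
  | mem x hx =>
    obtain ⟨p, rfl⟩ := hx
    refine Submodule.subset_span ⟨p, ?_⟩
    ext i
    simp only [Pi.sub_apply, map_sub, Pi.single_apply, apply_ite φ, map_zero]
  | zero =>
    simp only [Pi.zero_apply, map_zero]
    exact Submodule.zero_mem _
  | add x y _ _ hx hy =>
    simp only [Pi.add_apply, map_add]
    exact Submodule.add_mem _ hx hy
  | smul a x _ hx =>
    simp only [Pi.smul_apply, smul_eq_mul, map_mul]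
    exact Submodule.smul_mem _ (φ a) hx

theorem IsKoszul.map_ringEquiv [Fintype ι] [DecidableEq ι] {f : ι → R} (hf : IsKoszul f)
    (e : R ≃+* S) : IsKoszul fun i => e (f i) := by
  intro G hG
  have h1 := hf (fun i => e.symm (G i)) (by
    apply e.injective
    simpa using hG)
  simpa using map_mem_koszulSyzygies e.toRingHom h1

theorem IsKoszul.polynomial [Fintype ι] [DecidableEq ι] {f : ι → R} (hf : IsKoszul f) :
    IsKoszul fun i => Polynomial.C (f i) := by
  intro G hG
  have hcoeff : ∀ m : ℕ, (fun i => (G i).coeff m) ∈ koszulSyzygies f := by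
    intro m
    apply hf
    have := congrArg (fun P => Polynomial.coeff P m) hG
    simpa [Polynomial.finsetSum_coeff] using this
  have hsum : G = ∑ m ∈ Finset.range (Finset.univ.sup (fun i => (G i).natDegree) + 1),
      (Polynomial.X ^ m : Polynomial R) • fun i => Polynomial.C ((G i).coeff m) := by
    ext1 i
    rw [Finset.sum_apply]
    conv_lhs => rw [(G i).as_sum_range_C_mul_X_pow' (n := Finset.univ.sup
      (fun i => (G i).natDegree) + 1) (Nat.lt_succ_of_le
        (Finset.le_sup (f := fun i => (G i).natDegree) (Finset.mem_univ i)))]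
    refine Finset.sum_congr rfl fun m _ => ?_
    rw [Pi.smul_apply, smul_eq_mul, mul_comm]
  rw [hsum]
  exact Submodule.sum_mem _ fun m _ =>
    Submodule.smul_mem _ _ (map_mem_koszulSyzygies Polynomial.C (hcoeff m))

theorem IsKoszul.mem_koszulSyzygies_cons {n : ℕ} {f : Fin n → R} (hf : IsKoszul f) {a : R}
    {G : Fin (n + 1) → R} (h0 : G 0 ∈ Ideal.span (Set.range f))
    (hG : ∑ i, G i * (Fin.cons a f : Fin (n + 1) → R) i = 0) :
    G ∈ koszulSyzygies (Fin.cons a f : Fin (n + 1) → R) := by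
  obtain ⟨H, hH⟩ := Ideal.mem_span_range_iff_exists_fun.1 h0
  rw [Fin.sum_univ_succ] at hG
  simp only [Fin.cons_zero, Fin.cons_succ] at hG
  have htail : (fun i : Fin n => G i.succ + H i * a) ∈ koszulSyzygies f := by
    apply hf
    simp only [add_mul, Finset.sum_add_distrib]
    rw [← hG, ← hH, Finset.sum_mul, add_comm]
    congr 1
    exact Finset.sum_congr rfl fun i _ => by ring
  have hcons : ∀ x ∈ koszulSyzygies f, (Fin.cons 0 x : Fin (n + 1) → R) ∈
      koszulSyzygies (Fin.cons a f : Fin (n + 1) → R) := by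
    intro x hx
    induction hx using Submodule.span_induction with
    | mem x hx =>
      obtain ⟨p, rfl⟩ := hx
      refine Submodule.subset_span ⟨(p.1.succ, p.2.succ), ?_⟩
      ext i
      refine Fin.cases ?_ (fun j => ?_) i
      · simp
      · simp [Pi.single_apply]
    | zero =>
      convert Submodule.zero_mem _
      ext i
      refine Fin.cases ?_ (fun j => ?_) i <;> simp
    | add x y _ _ hx hy =>
      convert Submodule.add_mem _ hx hy
      ext i
      refine Fin.cases ?_ (fun j => ?_) i <;> simp
    | smul b x _ hx =>
      convert Submodule.smul_mem _ b hx
      ext i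
      refine Fin.cases ?_ (fun j => ?_) i <;> simp
  have hG' : G = Fin.cons 0 (fun i : Fin n => G i.succ + H i * a) + ∑ i, H i •
      ((Pi.single 0 ((Fin.cons a f : Fin (n + 1) → R) i.succ) -
        Pi.single i.succ ((Fin.cons a f : Fin (n + 1) → R) 0) : Fin (n + 1) → R)) := by
    ext i
    refine Fin.cases ?_ (fun j => ?_) i
    · simp [← hH]
    · simp [Pi.single_apply]
  rw [hG']
  exact Submodule.add_mem _ (hcons _ htail) (Submodule.sum_mem _ fun i _ =>
    Submodule.smul_mem _ _ (Submodule.subset_span ⟨(0, i.succ), rfl⟩))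

end Koszul

/-! ### A complete intersection with the strong Lefschetz property -/

section Special

variable {K : Type*} [Field K]

theorem mem_gradedPart_iff_finSuccEquiv {n : ℕ} {t : ℤ} {p : MvPolynomial (Fin (n + 1)) K} :
    p ∈ gradedPart (Fin (n + 1)) K t ↔ IsPolyGraded t (finSuccEquiv K n p) := by
  have hdeg : ∀ (m : ℕ) (μ : Fin n →₀ ℕ), (Finsupp.cons m μ).degree = m + μ.degree := by
    intro m μ
    simp [Finsupp.degree_eq_sum, Fin.sum_univ_succ]
  constructor
  · intro hp m
    rw [mem_gradedPart]
    intro μ hμ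
    rw [finSuccEquiv_coeff_coeff] at hμ
    have := mem_gradedPart.1 hp _ hμ
    rw [hdeg] at this
    push_cast at this
    omega
  · intro hp
    rw [mem_gradedPart]
    intro μ hμ
    rw [← Finsupp.cons_tail μ, ← finSuccEquiv_coeff_coeff] at hμ
    have := mem_gradedPart.1 (hp _) _ hμ
    rw [← Finsupp.cons_tail μ, hdeg]
    push_cast
    omega

/-- The first variable, or `0` when there are no variables. -/
noncomputable def firstVar (K : Type*) [Field K] : (n : ℕ) → MvPolynomial (Fin n) K
  | 0 => 0
  | _ + 1 => X 0

theorem firstVar_mem_gradedPart (n : ℕ) : firstVar K n ∈ gradedPart (Fin n) K 1 := by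
  cases n with
  | zero => exact Submodule.zero_mem _
  | succ n => exact X_mem_gradedPart _

theorem isLefschetz_of_isEmpty (f : Fin 0 → MvPolynomial (Fin 0) K) :
    IsLefschetz (Ideal.span (Set.range f)) (firstVar K 0) 0 := by
  have hJ : Ideal.span (Set.range f) = ⊥ := by simp [Set.range_eq_empty]
  have h0 : ∀ (t : ℤ), t ≠ 0 → ∀ p ∈ gradedPart (Fin 0) K t, p = 0 := by
    intro t ht p hp
    ext μ
    by_contra h
    apply ht
    rw [← mem_gradedPart.1 hp μ (by simpa using h), Subsingleton.elim μ 0]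
    simp
  rw [hJ]
  constructor
  · intro s k hk p hp hpk
    by_cases hs : s = 0
    · obtain rfl : k = 0 := by omega
      simpa using hpk
    · rw [h0 s hs p hp]
      exact Ideal.zero_mem _
  · intro s k hk y hy
    by_cases hs : s = 0
    · obtain rfl : k = 0 := by omega
      exact ⟨y, by simpa using hy, by simp⟩
    · refine ⟨0, Submodule.zero_mem _, ?_⟩
      rw [h0 _ (by omega) y hy]
      simp

theorem exists_isKoszul_isLefschetz_firstVar [Infinite K] (n : ℕ) (d : Fin n → ℕ)
    (hd : ∀ i, 1 ≤ d i) : ∃ f : Fin n → MvPolynomial (Fin n) K,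
      (∀ i, f i ∈ gradedPart (Fin n) K (d i)) ∧ IsKoszul f ∧
      IsLefschetz (Ideal.span (Set.range f)) (firstVar K n) (∑ i, ((d i : ℤ) - 1)) := by
  induction n with
  | zero =>
    refine ⟨fun _ => 0, fun i => i.elim0, fun G _ => ?_, ?_⟩
    swap
    · rw [Finset.univ_eq_empty, Finset.sum_empty]
      exact isLefschetz_of_isEmpty _
    rw [Subsingleton.elim G 0]
    exact Submodule.zero_mem _
  | succ n ih =>
    obtain ⟨f, hfd, hfK, hfL⟩ := ih (fun i => d i.succ) fun i => hd _
    set J := Ideal.span (Set.range f) with hJ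
    set c : ℤ := ∑ i : Fin n, ((d i.succ : ℤ) - 1) with hc
    obtain ⟨g, hg, hdet⟩ := exists_toeplitz_det_ne_zero K (d 0) ((c + 1).toNat + 1)
    have hg0 : g 0 ≠ 0 := by
      have := hdet 0 le_rfl (by omega) 1 (by omega)
      simpa using this
    have hdet' : ∀ e : ℤ, 0 ≤ e → e ≤ d 0 → ∀ N ≤ (c + 1).toNat,
        (Matrix.of fun a b : Fin N => g (e + (a : ℕ) - (b : ℕ))).det ≠ 0 :=
      fun e h0 h1 N hN => hdet e h0 h1 N (by omega)
    have hl := firstVar_mem_gradedPart (K := K) n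
    set φ := finSuccEquiv K n with hφ
    set G₀ := toeplitzForm g (firstVar K n) (d 0) with hG₀
    set F : Fin (n + 1) → MvPolynomial (Fin (n + 1)) K :=
      Fin.cons (φ.symm G₀) fun i => φ.symm (Polynomial.C (f i)) with hF
    have hFd : ∀ i, F i ∈ gradedPart (Fin (n + 1)) K (d i) := by
      intro i
      rw [mem_gradedPart_iff_finSuccEquiv]
      refine Fin.cases ?_ (fun j => ?_) i
      · rw [hF, Fin.cons_zero, ← hφ, AlgEquiv.apply_symm_apply]
        exact isPolyGraded_toeplitzForm hg hl
      · intro m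
        simp only [hF, Fin.cons_succ, ← hφ, AlgEquiv.apply_symm_apply, Polynomial.coeff_C]
        split_ifs with hm
        · subst hm
          simpa using hfd j
        · exact Submodule.zero_mem _
    have hJC : ∀ P : MvPolynomial (Fin (n + 1)) K,
        P ∈ Ideal.span (Set.range fun i => φ.symm (Polynomial.C (f i))) ↔
          φ P ∈ J.map Polynomial.C := by
      intro P
      rw [hJ, Ideal.map_span, ← Set.range_comp, Ideal.mem_span_range_iff_exists_fun,
        Ideal.mem_span_range_iff_exists_fun]
      constructor
      · rintro ⟨a, rfl⟩
        exact ⟨fun i => φ (a i), by simp⟩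
      · rintro ⟨a, ha⟩
        refine ⟨fun i => φ.symm (a i), φ.injective ?_⟩
        rw [← ha]
        simp
    have hspan : ∀ P : MvPolynomial (Fin (n + 1)) K, P ∈ Ideal.span (Set.range F) ↔
        ∃ Q, φ P - G₀ * Q ∈ J.map Polynomial.C := by
      intro P
      rw [hF, Fin.range_cons, Ideal.mem_span_insert]
      constructor
      · rintro ⟨a, z, hz, rfl⟩
        refine ⟨φ a, ?_⟩
        rw [map_add, map_mul, AlgEquiv.apply_symm_apply, mul_comm, add_sub_cancel_left]
        exact (hJC z).1 hz
      · rintro ⟨Q, hQ⟩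
        refine ⟨φ.symm Q, φ.symm (φ P - G₀ * Q), (hJC _).2 (by simpa using hQ), ?_⟩
        rw [map_sub, map_mul, AlgEquiv.symm_apply_apply]
        ring
    have hX : φ (firstVar K (n + 1)) = Polynomial.X := finSuccEquiv_X_zero
    have hcsum : ∑ i, ((d i : ℤ) - 1) = c + d 0 - 1 := by
      rw [Fin.sum_univ_succ, hc]
      ring
    refine ⟨F, hFd, ?_, ?_, ?_⟩
    · intro G hG
      have hK : IsKoszul fun i => φ.symm (Polynomial.C (f i)) :=
        hfK.polynomial.map_ringEquiv φ.symm.toRingEquiv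
      refine hK.mem_koszulSyzygies_cons ?_ hG
      rw [hJC]
      refine mem_of_mul_toeplitzForm_mem (l := firstVar K n) hg hg0 ?_
      have h1 : φ.symm (φ (G 0) * G₀) ∈
          Ideal.span (Set.range fun i => φ.symm (Polynomial.C (f i))) := by
        rw [Fin.sum_univ_succ] at hG
        rw [map_mul, AlgEquiv.symm_apply_apply]
        have h2 : G 0 * φ.symm G₀ = -∑ i : Fin n, G i.succ * F i.succ :=
          eq_neg_of_add_eq_zero_left hG
        rw [h2]
        exact Ideal.neg_mem_iff _ |>.2 (Ideal.sum_mem _ fun i _ =>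
          Ideal.mul_mem_left _ _ (Ideal.subset_span ⟨i, rfl⟩))
      simpa using (hJC _).1 h1
    · intro s k hk p hp hpk
      rw [hcsum] at hk
      obtain ⟨q, hq, hpq⟩ := exists_graded_of_mem_span hFd (t := s + k) (by
        have := gradedPart_mul_mem (gradedPart_pow_mem (firstVar_mem_gradedPart (n + 1)) k) hp
        rwa [add_comm (k : ℤ) s] at this) hpk
      rw [hspan]
      refine exists_of_X_pow_mul_sub_mem hfL hl hg hdet' hk (k := k) (s := s)
        (mem_gradedPart_iff_finSuccEquiv.1 (hq 0)) ?_
      have h1 := congrArg φ hpq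
      rw [Fin.sum_univ_succ, map_add, map_mul, map_mul, map_pow, hX] at h1
      rw [h1, hF]
      simp only [Fin.cons_zero, Fin.cons_succ, AlgEquiv.apply_symm_apply, ← hφ]
      rw [mul_comm G₀, add_sub_cancel_left, ← hJC]
      exact Ideal.sum_mem _ fun i _ => Ideal.mul_mem_left _ _ (Ideal.subset_span ⟨i, rfl⟩)
    · intro s k hk y hy
      rw [hcsum] at hk
      obtain ⟨P, Q, hP, hPQ⟩ := exists_sub_X_pow_mul_sub_mem hfL hl hg hdet' hk
        (mem_gradedPart_iff_finSuccEquiv.1 hy)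
      refine ⟨φ.symm P, ?_, ?_⟩
      · rwa [mem_gradedPart_iff_finSuccEquiv, ← hφ, AlgEquiv.apply_symm_apply]
      · rw [hspan]
        refine ⟨Q, ?_⟩
        rwa [map_sub, map_mul, map_pow, hX, AlgEquiv.apply_symm_apply]

theorem rename_mem_gradedPart {σ τ : Type*} (e : σ → τ) {t : ℤ} {p : MvPolynomial σ K}
    (hp : p ∈ gradedPart σ K t) : rename e p ∈ gradedPart τ K t := by
  rw [mem_gradedPart]
  intro μ hμ
  obtain ⟨ν, rfl, hν⟩ := coeff_rename_ne_zero e p μ hμ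
  rw [← mem_gradedPart.1 hp ν hν, Finsupp.degree_mapDomain]

/-- In every characteristic there are complete intersections of each type for which any given
variable is a strong Lefschetz element. -/
theorem exists_isKoszul_isLefschetz_X [Infinite K] {n : ℕ} {z : Fin n} (d : Fin n → ℕ)
    (hd : ∀ i, 1 ≤ d i) : ∃ f : Fin n → MvPolynomial (Fin n) K,
      (∀ i, f i ∈ gradedPart (Fin n) K (d i)) ∧ IsKoszul f ∧
      IsLefschetz (Ideal.span (Set.range f)) (X z) (∑ i, ((d i : ℤ) - 1)) := by
  obtain ⟨f, hfd, hfK, hfL⟩ := exists_isKoszul_isLefschetz_firstVar (K := K) n d hd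
  obtain ⟨e, he⟩ : ∃ e : Fin n ≃ Fin n, rename e (firstVar K n) = X z := by
    cases n with
    | zero => exact z.elim0
    | succ n => exact ⟨Equiv.swap 0 z, by simp [firstVar]⟩
  set ψ := renameEquiv K e with hψ
  have hψg : ∀ {t : ℤ} {p : MvPolynomial (Fin n) K},
      p ∈ gradedPart (Fin n) K t → ψ p ∈ gradedPart (Fin n) K t :=
    fun hp => rename_mem_gradedPart e hp
  have hψg' : ∀ {t : ℤ} {p : MvPolynomial (Fin n) K},
      p ∈ gradedPart (Fin n) K t → ψ.symm p ∈ gradedPart (Fin n) K t :=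
    fun hp => rename_mem_gradedPart e.symm hp
  have hspan : ∀ p, ψ p ∈ Ideal.span (Set.range fun i => ψ (f i)) ↔
      p ∈ Ideal.span (Set.range f) := by
    intro p
    rw [Ideal.mem_span_range_iff_exists_fun, Ideal.mem_span_range_iff_exists_fun]
    constructor
    · rintro ⟨a, ha⟩
      exact ⟨fun i => ψ.symm (a i), ψ.injective (by simpa using ha)⟩
    · rintro ⟨a, rfl⟩
      exact ⟨fun i => ψ (a i), by simp⟩
  have hX : ψ (firstVar K n) = X z := he
  refine ⟨fun i => ψ (f i), fun i => hψg (hfd i), hfK.map_ringEquiv ψ.toRingEquiv, ?_, ?_⟩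
  · intro s k hk p hp hpk
    have h1 := hfL.inj s k hk (ψ.symm p) (hψg' hp) (by
      rw [← hspan, map_mul, map_pow, hX, AlgEquiv.apply_symm_apply]
      exact hpk)
    rw [← hspan, AlgEquiv.apply_symm_apply] at h1
    exact h1
  · intro s k hk y hy
    obtain ⟨p, hp, hyp⟩ := hfL.surj s k hk (ψ.symm y) (hψg' hy)
    refine ⟨ψ p, hψg hp, ?_⟩
    rw [← hspan, map_sub, map_mul, map_pow, hX, AlgEquiv.apply_symm_apply] at hyp
    exact hyp

end Special

/-! ### Semicontinuity of the rank -/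

section Semicontinuity

variable {R K : Type*} [CommRing R] [Field K]

theorem exists_det_ne_zero_of_linearIndependent {ι τ : Type*} [Fintype ι] [DecidableEq ι]
    {w : ι → τ → K} (hw : LinearIndependent K w) :
    ∃ b : ι → τ, (Matrix.of fun i j => w i (b j)).det ≠ 0 := by
  have hspan : Submodule.span K (Set.range fun t i => w i t) = ⊤ := by
    by_contra h
    obtain ⟨f, hf0, hf⟩ := Submodule.exists_le_ker_of_lt_top _ (lt_top_iff_ne_top.2 h)
    apply hf0
    have hsum : ∀ t, ∑ i, w i t * f (fun j => if i = j then 1 else 0) = 0 := by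
      intro t
      have := hf (Submodule.subset_span ⟨t, rfl⟩)
      rw [LinearMap.mem_ker, LinearMap.pi_apply_eq_sum_univ] at this
      simpa using this
    have hzero := Fintype.linearIndependent_iff.1 hw
      (fun i => f (fun j => if i = j then 1 else 0)) (by
        ext t
        rw [Finset.sum_apply, Pi.zero_apply]
        refine Eq.trans (Finset.sum_congr rfl fun i _ => ?_) (hsum t)
        rw [Pi.smul_apply, smul_eq_mul, mul_comm])
    refine LinearMap.ext fun x => ?_
    rw [LinearMap.pi_apply_eq_sum_univ]
    simp [hzero]
  obtain ⟨κ, a, -, ha, hli⟩ := exists_linearIndependent' K fun t i => w i t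
  rw [hspan] at ha
  let B := Module.Basis.mk hli ha.ge
  let e : ι ≃ κ := (Pi.basisFun K ι).indexEquiv B
  refine ⟨fun j => a (e j), ?_⟩
  rw [← isUnit_iff_ne_zero, ← Matrix.isUnit_iff_isUnit_det, ← Matrix.linearIndependent_cols_iff_isUnit]
  exact hli.comp e e.injective

/-- The dimension of the span of a family of vectors whose coordinates are specialized along
`ψ` is at most the dimension when they are specialized along an injective homomorphism `φ`. -/
theorem finrank_span_le_of_specialization {φ ψ : R →+* K} (hφ : Function.Injective φ)
    {ι τ V : Type*} [Finite ι] [AddCommGroup V] [Module K V] {T : V →ₗ[K] τ → K}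
    (hT : Function.Injective T) (v : ι → τ → R) {w₁ w₂ : ι → V}
    (h₁ : ∀ i t, T (w₁ i) t = φ (v i t)) (h₂ : ∀ i t, T (w₂ i) t = ψ (v i t)) :
    Module.finrank K (Submodule.span K (Set.range w₂)) ≤
      Module.finrank K (Submodule.span K (Set.range w₁)) := by
  classical
  obtain ⟨κ, a, ha, hspan, hli⟩ := exists_linearIndependent' K w₂
  have := Finite.of_injective a ha
  have := Fintype.ofFinite κ
  obtain ⟨b, hb⟩ := exists_det_ne_zero_of_linearIndependent
    (hli.map' T (LinearMap.ker_eq_bot.2 hT))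
  have hψ : (Matrix.of fun i j => T (w₂ (a i)) (b j)) =
      ψ.mapMatrix (Matrix.of fun i j => v (a i) (b j)) := by
    ext i j
    exact h₂ _ _
  have hφ' : (Matrix.of fun i j => T (w₁ (a i)) (b j)) =
      φ.mapMatrix (Matrix.of fun i j => v (a i) (b j)) := by
    ext i j
    exact h₁ _ _
  have hdet : (Matrix.of fun i j => T (w₁ (a i)) (b j)).det ≠ 0 := by
    rw [hφ', ← RingHom.map_det]
    intro h
    rw [map_eq_zero_iff φ hφ] at h
    apply hb
    change (Matrix.of fun i j => T (w₂ (a i)) (b j)).det = 0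
    rw [hψ, ← RingHom.map_det, h, map_zero]
  have hli' : LinearIndependent K (w₁ ∘ a) := by
    refine LinearIndependent.of_comp (LinearMap.funLeft K K b ∘ₗ T) ?_
    have := Matrix.linearIndependent_rows_iff_isUnit.2
      ((Matrix.isUnit_iff_isUnit_det _).2 (isUnit_iff_ne_zero.2 hdet))
    exact this
  rw [← hspan, finrank_span_eq_card hli, ← finrank_span_eq_card hli']
  have : FiniteDimensional K (Submodule.span K (Set.range w₁)) :=
    FiniteDimensional.span_of_finite K (Set.finite_range _)
  exact Submodule.finrank_mono (Submodule.span_mono (Set.range_comp_subset_range a w₁))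

end Semicontinuity

/-! ### Graded relations of a sequence of forms -/

section Relations

variable {σ K : Type*} [Field K] {m : ℕ}

/-- Tuples of forms `G i` such that `G i * F i` has degree `T` when `F i` has degree `e i`. -/
noncomputable def gradedTuples (σ K : Type*) [Field K] {m : ℕ} (e : Fin m → ℤ) (T : ℤ) :
    Submodule K (Fin m → MvPolynomial σ K) :=
  Submodule.pi Set.univ fun i => gradedPart σ K (T - e i)

theorem mem_gradedTuples {e : Fin m → ℤ} {T : ℤ} {G : Fin m → MvPolynomial σ K} :
    G ∈ gradedTuples σ K e T ↔ ∀ i, G i ∈ gradedPart σ K (T - e i) := by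
  simp [gradedTuples, Submodule.mem_pi]

/-- The linear map sending a tuple `G` to `∑ i, G i * F i`. -/
noncomputable def combination (F : Fin m → MvPolynomial σ K) :
    (Fin m → MvPolynomial σ K) →ₗ[K] MvPolynomial σ K :=
  ∑ i, LinearMap.mulRight K (F i) ∘ₗ LinearMap.proj i

theorem combination_apply (F G : Fin m → MvPolynomial σ K) :
    combination F G = ∑ i, G i * F i := by
  simp [combination]

theorem gradedTuples_eq_span (e : Fin m → ℤ) (T : ℤ) : gradedTuples σ K e T =
    Submodule.span K (Set.range
      fun p : Σ i : Fin m, {μ : σ →₀ ℕ // (μ.degree : ℤ) = T - e i} =>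
        (Pi.single p.1 (monomial p.2.1 (1 : K)) : Fin m → MvPolynomial σ K)) := by
  apply le_antisymm
  · intro G hG
    rw [mem_gradedTuples] at hG
    rw [← Finset.univ_sum_single G]
    refine Submodule.sum_mem _ fun i _ => ?_
    have h1 := hG i
    rw [gradedPart_eq_span] at h1
    have h2 := Submodule.mem_map_of_mem
      (f := LinearMap.single K (fun _ : Fin m => MvPolynomial σ K) i) h1
    rw [Submodule.map_span] at h2
    refine Submodule.span_mono ?_ h2
    rintro _ ⟨_, ⟨μ, rfl⟩, rfl⟩
    exact ⟨⟨i, μ⟩, rfl⟩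
  · rw [Submodule.span_le]
    rintro _ ⟨⟨i, μ⟩, rfl⟩
    refine mem_gradedTuples.2 fun j => ?_
    rcases eq_or_ne i j with rfl | hij
    · have := monomial_mem_gradedPart μ.1 (1 : K)
      rw [μ.2] at this
      simpa using this
    · simp only [Pi.single_apply, if_neg hij.symm]
      exact Submodule.zero_mem _

instance finiteDimensional_gradedTuples [Finite σ] (e : Fin m → ℤ) (T : ℤ) :
    FiniteDimensional K (gradedTuples σ K e T) := by
  rw [gradedTuples_eq_span]
  exact FiniteDimensional.span_of_finite K (Set.finite_range _)

theorem map_combination_eq_span (F : Fin m → MvPolynomial σ K) (e : Fin m → ℤ) (T : ℤ) :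
    (gradedTuples σ K e T).map (combination F) = Submodule.span K (Set.range
      fun p : Σ i : Fin m, {μ : σ →₀ ℕ // (μ.degree : ℤ) = T - e i} =>
        monomial p.2.1 (1 : K) * F p.1) := by
  rw [gradedTuples_eq_span, Submodule.map_span, ← Set.range_comp]
  congr 2
  ext1 p
  rw [Function.comp_apply, combination_apply, Finset.sum_eq_single p.1]
  · simp
  · intro j _ hj
    simp [hj]
  · simp

theorem finrank_map_combination_add [Finite σ] (F : Fin m → MvPolynomial σ K) (e : Fin m → ℤ)
    (T : ℤ) : Module.finrank K ((gradedTuples σ K e T).map (combination F)) +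
      Module.finrank K (gradedTuples σ K e T ⊓ (combination F).ker : Submodule K _) =
        Module.finrank K (gradedTuples σ K e T) := by
  rw [← LinearMap.finrank_range_add_finrank_ker
    ((combination F).domRestrict (gradedTuples σ K e T)), LinearMap.range_domRestrict,
    LinearMap.ker_domRestrict, ← Submodule.map_comap_subtype, Submodule.finrank_map_subtype_eq]

/-- The Koszul syzygy of `F` on the indices `i` and `j`. -/
noncomputable def koszulSyzygy {R : Type*} [CommRing R] (F : Fin m → R) (i j : Fin m) :
    Fin m → R :=
  Pi.single i (F j) - Pi.single j (F i)

/-- The span of the monomial multiples of Koszul syzygies in degree `T`. -/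
noncomputable def gradedKoszul (F : Fin m → MvPolynomial σ K) (e : Fin m → ℤ) (T : ℤ) :
    Submodule K (Fin m → MvPolynomial σ K) :=
  Submodule.span K (Set.range
    fun p : Σ i : Fin m × Fin m, {μ : σ →₀ ℕ // (μ.degree : ℤ) = T - e i.1 - e i.2} =>
      monomial p.2.1 (1 : K) • koszulSyzygy F p.1.1 p.1.2)

variable {F : Fin m → MvPolynomial σ K} {e : Fin m → ℤ}

theorem gradedKoszul_le (hF : ∀ i, F i ∈ gradedPart σ K (e i)) (T : ℤ) :
    gradedKoszul F e T ≤ gradedTuples σ K e T ⊓ (combination F).ker := by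
  rw [gradedKoszul, Submodule.span_le]
  rintro _ ⟨⟨⟨i, j⟩, μ⟩, rfl⟩
  refine ⟨mem_gradedTuples.2 fun k => ?_, ?_⟩
  · have hμ := monomial_mem_gradedPart μ.1 (1 : K)
    rw [μ.2] at hμ
    simp only [koszulSyzygy, Pi.smul_apply, Pi.sub_apply, smul_eq_mul, mul_sub]
    have h1 := gradedPart_mul_mem hμ (hF j)
    have h2 := gradedPart_mul_mem hμ (hF i)
    refine Submodule.sub_mem _ ?_ ?_
    · rw [Pi.single_apply]
      split_ifs with h
      · subst h
        simpa using h1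
      · simp
    · rw [Pi.single_apply]
      split_ifs with h
      · subst h
        simpa [sub_right_comm T (e i) (e k)] using h2
      · simp
  · rw [SetLike.mem_coe, LinearMap.mem_ker, combination_apply]
    simp only [koszulSyzygy, Pi.smul_apply, Pi.sub_apply, smul_eq_mul, mul_sub, sub_mul,
      Finset.sum_sub_distrib, Pi.single_apply, mul_ite, ite_mul, mul_zero, zero_mul,
      Finset.sum_ite_eq', Finset.mem_univ, if_true]
    ring

theorem mem_gradedKoszul_of_mem_koszulSyzygies (hF : ∀ i, F i ∈ gradedPart σ K (e i)) {T : ℤ}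
    {G : Fin m → MvPolynomial σ K} (hG : G ∈ koszulSyzygies F) (hGT : G ∈ gradedTuples σ K e T) :
    G ∈ gradedKoszul F e T := by
  obtain ⟨a, ha⟩ := (Submodule.mem_span_range_iff_exists_fun _).1 hG
  have hG' : G = ∑ p : Fin m × Fin m, gradedComp (T - e p.1 - e p.2) (a p) •
      koszulSyzygy F p.1 p.2 := by
    ext1 k
    rw [← gradedComp_of_mem (mem_gradedTuples.1 hGT k), ← ha, Finset.sum_apply, Finset.sum_apply,
      map_sum]
    refine Finset.sum_congr rfl fun p _ => ?_
    simp only [koszulSyzygy, Pi.smul_apply, Pi.sub_apply, smul_eq_mul, mul_sub, map_sub,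
      Pi.single_apply, mul_ite, mul_zero, apply_ite (gradedComp (T - e k)), map_zero]
    congr 1
    · split_ifs with h
      · rw [mul_comm, gradedComp_mul _ (hF p.2), mul_comm, h]
      · rfl
    · split_ifs with h
      · rw [mul_comm, gradedComp_mul _ (hF p.1), mul_comm, h, sub_right_comm]
      · rfl
  rw [hG']
  refine Submodule.sum_mem _ fun p _ => ?_
  have h1 := gradedComp_mem (T - e p.1 - e p.2) (a p)
  rw [gradedPart_eq_span] at h1
  have h2 := Submodule.mem_map_of_mem
    (f := (LinearMap.toSpanSingleton (MvPolynomial σ K) _ (koszulSyzygy F p.1 p.2)).restrictScalars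
      K) h1
  rw [Submodule.map_span] at h2
  refine Submodule.span_mono ?_ h2
  rintro _ ⟨_, ⟨μ, rfl⟩, rfl⟩
  exact ⟨⟨p, μ⟩, rfl⟩

theorem map_combination_le (hF : ∀ i, F i ∈ gradedPart σ K (e i)) (T : ℤ) :
    (gradedTuples σ K e T).map (combination F) ≤ gradedPart σ K T := by
  rintro _ ⟨G, hG, rfl⟩
  rw [combination_apply]
  refine Submodule.sum_mem _ fun i _ => ?_
  have := gradedPart_mul_mem (mem_gradedTuples.1 hG i) (hF i)
  rwa [sub_add_cancel] at this

/-- Exactness of the Koszul complex in its last two spots in degree `T` passes from a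
specialization to an injective specialization. -/
theorem koszul_exact_of_specialization [Finite σ] {R : Type*} [CommRing R] {φ ψ : R →+* K}
    (hφ : Function.Injective φ) {U : Fin m → MvPolynomial σ R} {T : ℤ}
    (hφe : ∀ i, map φ (U i) ∈ gradedPart σ K (e i))
    (hsurj : gradedPart σ K T ≤
      (gradedTuples σ K e T).map (combination fun i => map ψ (U i)))
    (hker : gradedTuples σ K e T ⊓ (combination fun i => map ψ (U i)).ker ≤
      gradedKoszul (fun i => map ψ (U i)) e T) :
    gradedPart σ K T ≤ (gradedTuples σ K e T).map (combination fun i => map φ (U i)) ∧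
    gradedTuples σ K e T ⊓ (combination fun i => map φ (U i)).ker ≤
      gradedKoszul (fun i => map φ (U i)) e T := by
  have hs := finrank_map_combination_add (fun i => map ψ (U i)) e T
  have hg := finrank_map_combination_add (fun i => map φ (U i)) e T
  have hsurj' := Submodule.finrank_mono hsurj
  have : FiniteDimensional K (gradedKoszul (fun i => map ψ (U i)) e T) :=
    FiniteDimensional.span_of_finite K (Set.finite_range _)
  have hker' := Submodule.finrank_mono hker
  have himage : Module.finrank K
      ((gradedTuples σ K e T).map (combination fun i => map ψ (U i))) ≤
      Module.finrank K ((gradedTuples σ K e T).map (combination fun i => map φ (U i))) := by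
    rw [map_combination_eq_span, map_combination_eq_span]
    refine finrank_span_le_of_specialization (ψ := ψ) hφ (T := LinearMap.pi fun t => lcoeff K t)
      (fun p q h => MvPolynomial.ext _ _ fun t => congrFun h t)
      (fun p t => coeff t (monomial p.2.1 (1 : R) * U p.1)) (fun p t => ?_) (fun p t => ?_)
    · simp only [LinearMap.pi_apply, lcoeff_apply, ← coeff_map, map_mul, map_monomial, map_one]
    · simp only [LinearMap.pi_apply, lcoeff_apply, ← coeff_map, map_mul, map_monomial, map_one]
  have hkoszul : Module.finrank K (gradedKoszul (fun i => map ψ (U i)) e T) ≤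
      Module.finrank K (gradedKoszul (fun i => map φ (U i)) e T) := by
    have hmap : ∀ (χ : R →+* K) (i j k : Fin m) (μ : σ →₀ ℕ),
        (monomial μ (1 : K) • koszulSyzygy (fun i => map χ (U i)) i j) k =
          map χ ((monomial μ (1 : R) • koszulSyzygy U i j) k) := by
      intro χ i j k μ
      simp [koszulSyzygy, Pi.single_apply, apply_ite (map χ), map_monomial]
    refine finrank_span_le_of_specialization (ψ := ψ) hφ
      (T := LinearMap.pi fun t : Fin m × (σ →₀ ℕ) =>
        lcoeff K t.2 ∘ₗ LinearMap.proj (φ := fun _ : Fin m => MvPolynomial σ K) t.1)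
      (fun p q h => _root_.funext fun k => MvPolynomial.ext _ _ fun t => congrFun h (k, t))
      (fun p t => coeff t.2 ((monomial p.2.1 (1 : R) • koszulSyzygy U p.1.1 p.1.2) t.1))
      (fun p t => ?_) (fun p t => ?_)
    · rw [← coeff_map, ← hmap]
      rfl
    · rw [← coeff_map, ← hmap]
      rfl
  have hle := Submodule.finrank_mono (gradedKoszul_le hφe T)
  constructor
  · exact (Submodule.eq_of_le_of_finrank_le (map_combination_le hφe T) (by omega)).ge
  · exact (Submodule.eq_of_le_of_finrank_le (gradedKoszul_le hφe T) (by omega)).ge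

end Relations

/-! ### Transfer to generic forms -/

section Generic

variable {σ K : Type*} [Field K] {n : ℕ}

theorem zero_mem_span_of_mem_gradedKoszul_cons {a : MvPolynomial σ K}
    {f : Fin n → MvPolynomial σ K} {e : Fin (n + 1) → ℤ} {T : ℤ}
    {G : Fin (n + 1) → MvPolynomial σ K} (hG : G ∈ gradedKoszul (Fin.cons a f) e T) :
    G 0 ∈ Ideal.span (Set.range f) := by
  induction hG using Submodule.span_induction with
  | mem x hx =>
    obtain ⟨⟨⟨i, j⟩, μ⟩, rfl⟩ := hx
    refine Ideal.mul_mem_left _ _ ?_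
    have hf : ∀ i, f i ∈ Ideal.span (Set.range f) := fun i => Ideal.subset_span ⟨i, rfl⟩
    cases i using Fin.cases <;> cases j using Fin.cases <;>
      simp [koszulSyzygy, hf, (Fin.succ_ne_zero _).symm]
  | zero => exact Submodule.zero_mem _
  | add x y _ _ hx hy => exact Submodule.add_mem _ hx hy
  | smul c x _ hx =>
    rw [Pi.smul_apply, smul_eq_C_mul]
    exact Ideal.mul_mem_left _ _ hx

variable {e : Fin n → ℤ} {f : Fin n → MvPolynomial σ K} {l : MvPolynomial σ K} {c : ℤ}

theorem cons_mem_gradedPart (hf : ∀ i, f i ∈ gradedPart σ K (e i)) (hl : l ∈ gradedPart σ K 1)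
    (k : ℕ) (i : Fin (n + 1)) : (Fin.cons (l ^ k) f : Fin (n + 1) → MvPolynomial σ K) i ∈
      gradedPart σ K ((Fin.cons (k : ℤ) e : Fin (n + 1) → ℤ) i) := by
  cases i using Fin.cases with
  | zero => exact gradedPart_pow_mem hl k
  | succ i => exact hf i

/-- In terms of the sequence `l ^ k, f 0, …, f (n - 1)`, the Lefschetz property says that the
Koszul complex is exact at its last two spots in degree `s + k`. -/
theorem IsLefschetz.koszul_exact (hL : IsLefschetz (Ideal.span (Set.range f)) l c)
    (hf : ∀ i, f i ∈ gradedPart σ K (e i)) (hl : l ∈ gradedPart σ K 1) (hK : IsKoszul f)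
    {s : ℤ} {k : ℕ} (hsk : 2 * s + k = c) :
    gradedPart σ K (s + k) ≤
      (gradedTuples σ K (Fin.cons k e) (s + k)).map (combination (Fin.cons (l ^ k) f)) ∧
    gradedTuples σ K (Fin.cons k e) (s + k) ⊓ (combination (Fin.cons (l ^ k) f)).ker ≤
      gradedKoszul (Fin.cons (l ^ k) f) (Fin.cons k e) (s + k) := by
  constructor
  · intro y hy
    obtain ⟨p, hp, hpy⟩ := hL.surj s k hsk y hy
    have hlp := gradedPart_mul_mem hp (gradedPart_pow_mem hl k)
    rw [mul_comm] at hlp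
    obtain ⟨a, ha, hsum⟩ := exists_graded_of_mem_span hf (Submodule.sub_mem _ hy hlp) hpy
    refine ⟨Fin.cons p a, mem_gradedTuples.2 fun i => ?_, ?_⟩
    · cases i using Fin.cases with
      | zero => simpa using hp
      | succ i => exact ha i
    · rw [combination_apply, Fin.sum_univ_succ]
      simp only [Fin.cons_zero, Fin.cons_succ]
      rw [← hsum]
      ring
  · rintro G ⟨hGT, hG⟩
    rw [SetLike.mem_coe, LinearMap.mem_ker, combination_apply] at hG
    refine mem_gradedKoszul_of_mem_koszulSyzygies (cons_mem_gradedPart hf hl k) ?_ hGT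
    refine hK.mem_koszulSyzygies_cons (hL.inj s k hsk _ ?_ ?_) hG
    · have := mem_gradedTuples.1 hGT 0
      rwa [Fin.cons_zero, add_sub_cancel_right] at this
    · rw [Fin.sum_univ_succ] at hG
      simp only [Fin.cons_zero, Fin.cons_succ] at hG
      rw [mul_comm, eq_neg_of_add_eq_zero_left hG]
      exact Submodule.neg_mem _ (Submodule.sum_mem _ fun i _ =>
        Ideal.mul_mem_left _ _ (Ideal.subset_span ⟨i, rfl⟩))

theorem isLefschetz_of_koszul_exact (hf : ∀ i, f i ∈ gradedPart σ K (e i))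
    (hl : l ∈ gradedPart σ K 1) (h : ∀ (s : ℤ) (k : ℕ), 2 * s + k = c →
      gradedPart σ K (s + k) ≤
        (gradedTuples σ K (Fin.cons k e) (s + k)).map (combination (Fin.cons (l ^ k) f)) ∧
      gradedTuples σ K (Fin.cons k e) (s + k) ⊓ (combination (Fin.cons (l ^ k) f)).ker ≤
        gradedKoszul (Fin.cons (l ^ k) f) (Fin.cons k e) (s + k)) :
    IsLefschetz (Ideal.span (Set.range f)) l c where
  inj := by
    intro s k hsk p hp hpI
    have hlp := gradedPart_mul_mem hp (gradedPart_pow_mem hl k)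
    rw [mul_comm] at hlp
    obtain ⟨a, ha, hsum⟩ := exists_graded_of_mem_span hf hlp hpI
    have hG : (Fin.cons p (-a) : Fin (n + 1) → MvPolynomial σ K) ∈
        gradedTuples σ K (Fin.cons k e) (s + k) ⊓ (combination (Fin.cons (l ^ k) f)).ker := by
      refine ⟨mem_gradedTuples.2 fun i => ?_, ?_⟩
      · cases i using Fin.cases with
        | zero => simpa using hp
        | succ i => exact Submodule.neg_mem _ (ha i)
      · rw [SetLike.mem_coe, LinearMap.mem_ker, combination_apply, Fin.sum_univ_succ]
        simp only [Fin.cons_zero, Fin.cons_succ, Pi.neg_apply, neg_mul, Finset.sum_neg_distrib]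
        rw [← hsum]
        ring
    exact zero_mem_span_of_mem_gradedKoszul_cons ((h s k hsk).2 hG)
  surj := by
    intro s k hsk y hy
    obtain ⟨G, hGT, rfl⟩ := (h s k hsk).1 hy
    refine ⟨G 0, ?_, ?_⟩
    · have := mem_gradedTuples.1 hGT 0
      rwa [Fin.cons_zero, add_sub_cancel_right] at this
    · rw [combination_apply, Fin.sum_univ_succ]
      simp only [Fin.cons_zero, Fin.cons_succ]
      rw [mul_comm, add_sub_cancel_left]
      exact Submodule.sum_mem _ fun i _ =>
        Ideal.mul_mem_left _ _ (Ideal.subset_span ⟨i, rfl⟩)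

/-- The strong Lefschetz property passes from a specialization of a family of forms to an
injective specialization. -/
theorem isLefschetz_of_specialization [Finite σ] {R : Type*} [CommRing R] {φ ψ : R →+* K}
    (hφ : Function.Injective φ) {U : Fin n → MvPolynomial σ R} {z : σ}
    (hφe : ∀ i, map φ (U i) ∈ gradedPart σ K (e i))
    (hψe : ∀ i, map ψ (U i) ∈ gradedPart σ K (e i)) (hK : IsKoszul fun i => map ψ (U i))
    (hL : IsLefschetz (Ideal.span (Set.range fun i => map ψ (U i))) (X z) c) :
    IsLefschetz (Ideal.span (Set.range fun i => map φ (U i))) (X z) c := by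
  refine isLefschetz_of_koszul_exact hφe (X_mem_gradedPart z) fun s k hsk => ?_
  have hcons : ∀ χ : R →+* K, (fun i => map χ ((Fin.cons (X z ^ k) U :
      Fin (n + 1) → MvPolynomial σ R) i)) = Fin.cons (X z ^ k) fun i => map χ (U i) := by
    intro χ
    funext i
    cases i using Fin.cases <;> simp
  have hexact := hL.koszul_exact hψe (X_mem_gradedPart z) hK hsk
  have h := koszul_exact_of_specialization (ψ := ψ) hφ (U := Fin.cons (X z ^ k) U)
    (e := Fin.cons k e) (T := s + k)
  rw [hcons, hcons] at h
  refine h (fun i => ?_) hexact.1 hexact.2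
  rw [congrFun (hcons φ) i]
  exact cons_mem_gradedPart hφe (X_mem_gradedPart z) k i

/-- A form of degree `t` is the sum of its terms over the monomials of degree `t`. -/
theorem sum_monomial_coeff_of_degree {t : ℕ} [Fintype {μ : Fin n →₀ ℕ // expDeg μ = t}]
    {p : MvPolynomial (Fin n) K} (hp : p ∈ gradedPart (Fin n) K t) :
    ∑ μ : {μ : Fin n →₀ ℕ // expDeg μ = t}, monomial μ.1 (coeff μ.1 p) = p := by
  classical
  ext ν
  simp only [coeff_sum, coeff_monomial]
  by_cases hν : expDeg ν = t
  · rw [Finset.sum_eq_single ⟨ν, hν⟩]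
    · simp
    · intro μ _ hμ
      rw [if_neg fun h => hμ (Subtype.ext h)]
    · simp
  · rw [Finset.sum_eq_zero fun μ _ => if_neg (by rintro rfl; exact hν μ.2)]
    by_contra h
    have := mem_gradedPart.1 hp ν (Ne.symm h)
    exact hν (by rw [expDeg_eq_degree]; exact_mod_cast this)

theorem IsGenericSeq.isLefschetz [Infinite K] {F : Type*} [Field F] [Algebra F K]
    {d : Fin n → ℕ} (hd : ∀ i, 1 ≤ d i) {f : Fin n → MvPolynomial (Fin n) K}
    (hf : IsGenericSeq F d f) (z : Fin n) :
    IsLefschetz (Ideal.span (Set.range f)) (X z) (∑ i, ((d i : ℤ) - 1)) := by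
  have hfin : ∀ t : ℕ, Finite {μ : Fin n →₀ ℕ // expDeg μ = t} := fun t =>
    (Finsupp.finite_of_degree_eq t).to_subtype
  have : ∀ t : ℕ, Fintype {μ : Fin n →₀ ℕ // expDeg μ = t} := fun t => Fintype.ofFinite _
  obtain ⟨g, hg, hgK, hgL⟩ := exists_isKoszul_isLefschetz_X (K := K) (z := z) d hd
  have hfe : ∀ i, f i ∈ gradedPart (Fin n) K (d i) := fun i => mem_gradedPart_of_isHomogeneous (hf.1 i)
  let I := Σ i : Fin n, {μ : Fin n →₀ ℕ // expDeg μ = d i}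
  let U : Fin n → MvPolynomial (Fin n) (MvPolynomial I F) := fun i =>
    ∑ μ : {μ : Fin n →₀ ℕ // expDeg μ = d i}, monomial μ.1 (X ⟨i, μ⟩)
  let φ (h : Fin n → MvPolynomial (Fin n) K) : MvPolynomial I F →+* K :=
    (aeval fun p : I => (h p.1).coeff p.2.1 : MvPolynomial I F →ₐ[F] K)
  have hmap : ∀ h : Fin n → MvPolynomial (Fin n) K, (∀ i, h i ∈ gradedPart (Fin n) K (d i)) →
      (fun i => map (φ h) (U i)) = h := by
    intro h hh
    funext i
    rw [← sum_monomial_coeff_of_degree (hh i)]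
    simp [U, φ, map_sum, map_monomial]
  have h := isLefschetz_of_specialization (e := fun i => d i) (φ := φ f) (ψ := φ g) (U := U)
    (z := z) (c := ∑ i, ((d i : ℤ) - 1)) hf.2
  rw [hmap f hfe, hmap g hg] at h
  exact h (fun i => (congrFun (hmap f hfe) i).symm ▸ hfe i)
    (fun i => (congrFun (hmap g hg) i).symm ▸ hg i) hgK hgL

end Generic

/-- for `i > j ≥ i*` (with `d+i ≤ δ`), `a_{d+i} ≤ a_{d+j}` and `B_{d+i}` is
`x_n^{i−j}` times the set `S` of the `a_{d+i}` smallest monomials of `B_{d+j}`. -/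
theorem stmt5 {F K : Type*} [Field F] [Field K] [Algebra F K] [Infinite K]
    {n : ℕ} (hn : 0 < n) (d : Fin n → ℕ) (hd : ∀ i, 1 ≤ d i) (hmono : Monotone d)
    (D : ℕ) (hdD : ∀ i, d i ≤ D)
    (f : Fin n → MvPolynomial (Fin n) K) (hf : IsGenericSeq F d f)
    (J : Ideal (MvPolynomial (Fin n) K)) (hJ : J = Ideal.span (Set.range f))
    (δ istar : ℕ) (hδ : δ = (∑ j, d j) - n) (hDδ : D < δ) (histar : istar = (δ - D) / 2)
    (i j : ℕ) (hji : j < i) (hj : istar ≤ j) (hiδ : D + i ≤ δ) :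
    (stdMon J (D + i)).ncard ≤ (stdMon J (D + j)).ncard ∧
      ∃ S ⊆ stdMon J (D + j), S.ncard = (stdMon J (D + i)).ncard ∧
        (∀ s ∈ S, ∀ b ∈ stdMon J (D + j) \ S, DrlLT s b) ∧
        stdMon J (D + i) =
          (fun ν => ν + Finsupp.single (⟨n - 1, by omega⟩ : Fin n) (i - j)) '' S := by
  have hsum : (∑ j, ((d j : ℤ) - 1)) = δ := by
    have h : n ≤ ∑ j, d j := by
      simpa using Finset.sum_le_sum fun j (_ : j ∈ Finset.univ) => hd j
    rw [Finset.sum_sub_distrib, hδ, Nat.cast_sub h]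
    simp
  have hD := (hd ⟨0, hn⟩).trans (hdD _)
  have hL := hf.isLefschetz hd ⟨n - 1, by omega⟩
  rw [hsum, ← hJ] at hL
  have hI : ∀ (t : ℤ), ∀ p ∈ J, gradedComp t p ∈ J := by
    subst hJ
    exact fun t p => gradedComp_mem_span (fun k => mem_gradedPart_of_isHomogeneous (hf.1 k)) t
  obtain ⟨S, hS, hcard, hlt, himage⟩ := stdMon_smallest_of_isLefschetz hI
    (fun k => Fin.le_def.2 (by have := k.2; simp; omega)) hL
    (show D + j < D + i by omega) (by omega) hiδ
  refine ⟨hcard ▸ Set.ncard_le_ncard hS (stdMon_finite J _), S, hS, hcard, hlt, ?_⟩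
  rwa [Nat.add_sub_add_left] at himage
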